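/- Assume δ_i·δ_j' ≡ 0 for all i,j, the 2n vectors δ_1(t),…,δ_n(t),δ_1'(t),…,δ_n'(t) are linearly independent for each t, and γ is a striction curve (γ'·δ_i' ≡ 0 for all i). Then for each t₀ ∈ J, the germ of F_{(γ,δ)} at the singular point (t₀,0,…,0) is a 1-Morin singularity — i.e. A-equivalent to the germ at 0 of (x_1,…,x_n, x_1x_{n+1}, x_2x_{n+1}, …, x_{n−1}x_{n+1}, x_{n+1}²) : (ℝ^{n+1},0) → (ℝ^{2n},0) — if and only if γ'(t₀) ≠ 0. -/

import Mathlib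

open Filter Topology Matrix

noncomputable section

/-- The standard inner product on `ℝ^N`. -/
def dp {N : ℕ} (v w : Fin N → ℝ) : ℝ := ∑ i, v i * w i

/-- The Gram matrix `G(t) = (δ_i'(t) · δ_j'(t))_{i,j}`. -/
def gram {n : ℕ} (δ : Fin n → ℝ → (Fin (2 * n) → ℝ)) (t : ℝ) : Matrix (Fin n) (Fin n) ℝ :=
  Matrix.of fun i j => dp (deriv (δ i) t) (deriv (δ j) t)

/-- `(u_1(t), …, u_n(t)) = - G(t)⁻¹ (γ'(t)·δ_1'(t), …, γ'(t)·δ_n'(t))`. -/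
def strictU {n : ℕ} (γ : ℝ → (Fin (2 * n) → ℝ)) (δ : Fin n → ℝ → (Fin (2 * n) → ℝ))
    (t : ℝ) : Fin n → ℝ :=
  -((gram δ t)⁻¹.mulVec (fun i => dp (deriv γ t) (deriv (δ i) t)))

/-- The curve `σ(t) = γ(t) + Σ_i u_i(t) δ_i(t)`. -/
def strictCurve {n : ℕ} (γ : ℝ → (Fin (2 * n) → ℝ)) (δ : Fin n → ℝ → (Fin (2 * n) → ℝ))
    (t : ℝ) : Fin (2 * n) → ℝ :=
  γ t + ∑ i, strictU γ δ t i • δ i t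

/-- The one-parameter family of `n`-planes `F_{(γ,δ)}(t,u) = γ(t) + Σ_i u_i δ_i(t)`. -/
def ruled {n : ℕ} (γ : ℝ → (Fin (2 * n) → ℝ)) (δ : Fin n → ℝ → (Fin (2 * n) → ℝ)) :
    ℝ × (Fin n → ℝ) → (Fin (2 * n) → ℝ) :=
  fun p => γ p.1 + ∑ i, p.2 i • δ i p.1

/-- `F_{(γ,δ)}` viewed as a map `ℝ^{n+1} → ℝ^{2n}`, `x = (t, u_1, …, u_n)`. -/
def ruledF {n : ℕ} (γ : ℝ → (Fin (2 * n) → ℝ)) (δ : Fin n → ℝ → (Fin (2 * n) → ℝ)) :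
    (Fin (n + 1) → ℝ) → (Fin (2 * n) → ℝ) :=
  fun x => γ (x 0) + ∑ i, x i.succ • δ i (x 0)

/-- The point `(t₀, 0, …, 0) ∈ ℝ^{n+1}`. -/
def bpt {n : ℕ} (t₀ : ℝ) : Fin (n + 1) → ℝ := fun k => if k = 0 then t₀ else 0

def xhat' {m : ℕ} (x : Fin m → ℝ) (q : ℕ) : ℝ := if h : q < m then x ⟨q, h⟩ else 0

/-- The `1`-Morin (Whitney-umbrella type) normal form
`(x_1, …, x_n, x_1x_{n+1}, …, x_{n-1}x_{n+1}, x_{n+1}²) : (ℝ^{n+1},0) → (ℝ^{2n},0)`. -/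
def whitneyNF (n : ℕ) : (Fin (n + 1) → ℝ) → (Fin (2 * n) → ℝ) := fun x k =>
  if k.val < n then xhat' x k.val
  else if k.val < 2 * n - 1 then xhat' x (k.val - n) * xhat' x n
  else (xhat' x n) ^ 2

/-- `δ_q(t)` with a `ℕ` index (`0` if out of range). -/
def dhat {n : ℕ} (δ : Fin n → ℝ → (Fin (2 * n) → ℝ)) (q : ℕ) (t : ℝ) : Fin (2 * n) → ℝ :=
  if h : q < n then δ ⟨q, h⟩ t else 0

/-- `δ_q'(t)` with a `ℕ` index (`0` if out of range). -/
def dphat {n : ℕ} (δ : Fin n → ℝ → (Fin (2 * n) → ℝ)) (q : ℕ) (t : ℝ) : Fin (2 * n) → ℝ :=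
  if h : q < n then deriv (δ ⟨q, h⟩) t else 0

/-- `λ_j(t,u) = det(γ'(t) + Σ_i u_iδ_i'(t), δ_1(t), …, δ_n(t),
δ_1'(t), …, δ_{j-1}'(t), δ_{j+1}'(t), …, δ_n'(t))` (here `j : Fin n` is `0`-indexed,
correspondig to the paper's `λ_{j+1}`); the entries of the matrix are listed as columns. -/
def lamRuled {n : ℕ} (γ : ℝ → (Fin (2 * n) → ℝ)) (δ : Fin n → ℝ → (Fin (2 * n) → ℝ))
    (j : Fin n) : ℝ × (Fin n → ℝ) → ℝ := fun p =>
  Matrix.det (Matrix.of fun (row col : Fin (2 * n)) =>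
    if col.val = 0 then (deriv γ p.1 + ∑ i, p.2 i • deriv (δ i) p.1) row
    else if col.val < n + 1 then dhat δ (col.val - 1) p.1 row
    else dphat δ
      (if col.val - (n + 1) < j.val then col.val - (n + 1) else col.val - (n + 1) + 1)
      p.1 row)

/-- `Δ(t) = det(δ_1(t), …, δ_n(t), δ_1'(t), …, δ_n'(t))` (columns). -/
def bigDelta {n : ℕ} (δ : Fin n → ℝ → (Fin (2 * n) → ℝ)) (t : ℝ) : ℝ :=
  Matrix.det (Matrix.of fun (row col : Fin (2 * n)) =>
    if col.val < n then dhat δ col.val t row else dphat δ (col.val - n) t row)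

/-- A diffeomorphism-germ `(ℝ^k,0) → (ℝ^k,0)`: it fixes `0`, is smooth at `0` and its
differential at `0` is invertible. -/
def IsDiffeoGerm {k : ℕ} (σ : (Fin k → ℝ) → (Fin k → ℝ)) : Prop :=
  σ 0 = 0 ∧ ContDiffAt ℝ (⊤ : ℕ∞) σ 0 ∧ LinearMap.det ((fderiv ℝ σ 0).toLinearMap) ≠ 0

/-- `A`-equivalence of map-germs at `0`. -/
def AEquiv {m n : ℕ} (f g : (Fin m → ℝ) → (Fin n → ℝ)) : Prop :=
  ∃ (φ : (Fin m → ℝ) → (Fin m → ℝ)) (Φ : (Fin n → ℝ) → (Fin n → ℝ)),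
    IsDiffeoGerm φ ∧ IsDiffeoGerm Φ ∧ ∀ᶠ x in nhds 0, Φ (f (φ x)) = g x

open scoped ContDiff

theorem hasTemperateGrowth_fderiv {F G : Type} [NormedAddCommGroup F] [NormedSpace ℝ F]
    [NormedAddCommGroup G] [NormedSpace ℝ G] {M : F → G} (hM : M.HasTemperateGrowth) :
    (fderiv ℝ M).HasTemperateGrowth := by
  refine ⟨hM.1.fderiv_right (by simp), fun k ↦ ?_⟩
  obtain ⟨m, C, h⟩ := hM.2 (k + 1)
  exact ⟨m, C, fun x ↦ by rw [norm_iteratedFDeriv_fderiv]; exact h x⟩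

section ParametricIntegral

open MeasureTheory

variable {Ω E F : Type} [MeasurableSpace Ω] {μ : Measure Ω}
  [NormedAddCommGroup E] [NormedSpace ℝ E] [NormedAddCommGroup F] [NormedSpace ℝ F]
  {T : Ω → E →L[ℝ] F} {ρ : Ω → ℝ}

theorem hasFDerivAt_integral_comp_clm {G H : Type} [NormedAddCommGroup G] [NormedSpace ℝ G]
    [NormedAddCommGroup H] [NormedSpace ℝ H] [CompleteSpace H]
    (hT : AEStronglyMeasurable T μ) (hρ : ∀ z, 1 ≤ ρ z)
    (hTρ : ∀ z, ‖T z‖ ≤ ρ z) {φ : Ω → G →L[ℝ] H} (hφ : AEStronglyMeasurable φ μ)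
    (hint : ∀ k : ℕ, Integrable (fun z ↦ ρ z ^ k * ‖φ z‖) μ) {M : F → G}
    (hM : M.HasTemperateGrowth) (p : E) :
    HasFDerivAt (fun p ↦ ∫ z, φ z (M (T z p)) ∂μ)
      (∫ z, (φ z).comp ((fderiv ℝ M (T z p)).comp (T z)) ∂μ) p := by
  have hM' := hasTemperateGrowth_fderiv hM
  have hmeas : ∀ q : E, AEStronglyMeasurable (fun z ↦ T z q) μ := fun q ↦
    (ContinuousLinearMap.apply ℝ F q).continuous.comp_aestronglyMeasurable hT
  have hmeasF : ∀ q : E, AEStronglyMeasurable (fun z ↦ φ z (M (T z q))) μ := fun q ↦ by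
    have h1 : AEStronglyMeasurable (fun z ↦ M (T z q)) μ :=
      hM.1.continuous.comp_aestronglyMeasurable (hmeas q)
    exact isBoundedBilinearMap_apply.continuous.comp_aestronglyMeasurable (hφ.prodMk h1)
  have hT1 : ∀ z (q : E), 1 + ‖T z q‖ ≤ ρ z * (1 + ‖q‖) := fun z q ↦ by
    have := (T z).le_of_opNorm_le (hTρ z) q
    have := hρ z
    nlinarith
  have hbound : ∀ (N : F → ℝ) (k : ℕ) (C : ℝ), (∀ y, N y ≤ C * (1 + ‖y‖) ^ k) →
      ∀ z (q : E) (R : ℝ), ‖q‖ ≤ R → N (T z q) ≤ |C| * (ρ z ^ k * (1 + R) ^ k) := by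
    intro N k C h z q R hR
    have := hρ z
    calc N (T z q) ≤ C * (1 + ‖T z q‖) ^ k := h _
      _ ≤ |C| * (1 + ‖T z q‖) ^ k := by gcongr; exact le_abs_self C
      _ ≤ |C| * (ρ z * (1 + R)) ^ k := by
        gcongr
        exact (hT1 z q).trans (by gcongr)
      _ = _ := by rw [mul_pow]
  obtain ⟨k, C, h0⟩ := hM.2 0
  obtain ⟨k', C', h1⟩ := hM'.2 0
  simp only [norm_iteratedFDeriv_zero] at h0 h1
  refine hasFDerivAt_integral_of_dominated_of_fderiv_le (s := Metric.ball p 1)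
    (F' := fun q z ↦ (φ z).comp ((fderiv ℝ M (T z q)).comp (T z)))
    (bound := fun z ↦ (|C'| * (1 + (‖p‖ + 1)) ^ k') * (ρ z ^ (k' + 1) * ‖φ z‖))
    (Metric.ball_mem_nhds p one_pos) (.of_forall hmeasF) ?_ ?_ ?_ ?_ ?_
  · refine ((hint k).const_mul (|C| * (1 + ‖p‖) ^ k)).mono' (hmeasF p) (.of_forall fun z ↦ ?_)
    calc _ ≤ ‖φ z‖ * ‖M (T z p)‖ := (φ z).le_opNorm _
      _ ≤ ‖φ z‖ * (|C| * (ρ z ^ k * (1 + ‖p‖) ^ k)) := by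
        gcongr; exact hbound (fun y ↦ ‖M y‖) k C h0 z p _ le_rfl
      _ = _ := by ring
  · have h2 : AEStronglyMeasurable (fun z ↦ fderiv ℝ M (T z p)) μ :=
      hM'.1.continuous.comp_aestronglyMeasurable (hmeas p)
    have h3 := isBoundedBilinearMap_comp.continuous.comp_aestronglyMeasurable (h2.prodMk hT)
    exact isBoundedBilinearMap_comp.continuous.comp_aestronglyMeasurable (hφ.prodMk h3)
  · refine .of_forall fun z q hq ↦ ?_
    have hq' : ‖q‖ ≤ ‖p‖ + 1 := by
      have : ‖q - p‖ < 1 := by simpa [dist_eq_norm] using hq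
      have := norm_le_insert' q p
      linarith
    have := hρ z
    calc _ ≤ ‖φ z‖ * (‖fderiv ℝ M (T z q)‖ * ‖T z‖) :=
          (ContinuousLinearMap.opNorm_comp_le _ _).trans
            (by gcongr; exact ContinuousLinearMap.opNorm_comp_le _ _)
      _ ≤ ‖φ z‖ * (|C'| * (ρ z ^ k' * (1 + (‖p‖ + 1)) ^ k') * ρ z) := by
        gcongr
        · exact hbound (fun y ↦ ‖fderiv ℝ M y‖) k' C' h1 z q _ hq'
        · exact hTρ z
      _ = _ := by ring
  · exact (hint _).const_mul _
  · refine .of_forall fun z q _ ↦ ?_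
    exact (φ z).hasFDerivAt.comp q
      (((hM.1.differentiable (by simp)) _).hasFDerivAt.comp q (T z).hasFDerivAt)

theorem contDiff_nat_integral_comp_clm (hT : AEStronglyMeasurable T μ) (hρ : ∀ z, 1 ≤ ρ z)
    (hρm : AEStronglyMeasurable ρ μ) (hTρ : ∀ z, ‖T z‖ ≤ ρ z) (N : ℕ) :
    ∀ {G H : Type} [NormedAddCommGroup G] [NormedSpace ℝ G]
    [NormedAddCommGroup H] [NormedSpace ℝ H] [CompleteSpace H]
    {φ : Ω → G →L[ℝ] H} (_ : AEStronglyMeasurable φ μ)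
    (_ : ∀ k : ℕ, Integrable (fun z ↦ ρ z ^ k * ‖φ z‖) μ) {M : F → G}
    (_ : M.HasTemperateGrowth), ContDiff ℝ N (fun p ↦ ∫ z, φ z (M (T z p)) ∂μ) := by
  induction N with
  | zero =>
    intro G H _ _ _ _ _ φ hφ hint M hM
    refine contDiff_zero.2 (continuous_iff_continuousAt.2 fun p ↦ ?_)
    exact (hasFDerivAt_integral_comp_clm hT hρ hTρ hφ hint hM p).continuousAt
  | succ N ih =>
    intro G H _ _ _ _ _ φ hφ hint M hM
    refine contDiff_succ_iff_hasFDerivAt.2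
      ⟨_, ?_, fun p ↦ hasFDerivAt_integral_comp_clm hT hρ hTρ hφ hint hM p⟩
    let ψ : Ω → (F →L[ℝ] G) →L[ℝ] (E →L[ℝ] H) := fun z ↦
      (ContinuousLinearMap.compL ℝ E G H (φ z)).comp
        ((ContinuousLinearMap.compL ℝ E F G).flip (T z))
    have hψ : ∀ z, ‖ψ z‖ ≤ ‖φ z‖ * ρ z := fun z ↦ by
      refine ContinuousLinearMap.opNorm_le_bound _ (by have := hρ z; positivity) fun A ↦ ?_
      calc ‖(φ z).comp (A.comp (T z))‖ ≤ ‖φ z‖ * (‖A‖ * ‖T z‖) :=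
          (ContinuousLinearMap.opNorm_comp_le _ _).trans
            (by gcongr; exact ContinuousLinearMap.opNorm_comp_le _ _)
        _ ≤ ‖φ z‖ * (‖A‖ * ρ z) := by gcongr; exact hTρ z
        _ = _ := by ring
    have hψm : AEStronglyMeasurable ψ μ := by
      have h1 := (ContinuousLinearMap.compL ℝ E G H).continuous.comp_aestronglyMeasurable hφ
      have h2 := (ContinuousLinearMap.compL ℝ E F G).flip.continuous.comp_aestronglyMeasurable hT
      exact isBoundedBilinearMap_comp.continuous.comp_aestronglyMeasurable (h1.prodMk h2)
    refine ih (φ := ψ) hψm (fun k ↦ ?_) (hasTemperateGrowth_fderiv hM)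
    refine (hint (k + 1)).mono' ((hρm.pow k).mul hψm.norm) (.of_forall fun z ↦ ?_)
    have := hρ z
    rw [norm_mul, norm_norm, Real.norm_of_nonneg (by positivity)]
    calc _ ≤ ρ z ^ k * (‖φ z‖ * ρ z) := by gcongr; exact hψ z
      _ = _ := by ring

/-- Smooth dependence on parameters for `p ↦ ∫ φ_z (M (T_z p)) dz`, where `T_z` is linear, `M` has
temperate growth and `φ` is integrable against all powers of a bound for `T`. -/
theorem contDiff_integral_comp_clm {G H : Type} [NormedAddCommGroup G] [NormedSpace ℝ G]
    [NormedAddCommGroup H] [NormedSpace ℝ H] [CompleteSpace H]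
    (hT : AEStronglyMeasurable T μ) (hρ : ∀ z, 1 ≤ ρ z)
    (hρm : AEStronglyMeasurable ρ μ) (hTρ : ∀ z, ‖T z‖ ≤ ρ z)
    {φ : Ω → G →L[ℝ] H} (hφ : AEStronglyMeasurable φ μ)
    (hint : ∀ k : ℕ, Integrable (fun z ↦ ρ z ^ k * ‖φ z‖) μ) {M : F → G}
    (hM : M.HasTemperateGrowth) : ContDiff ℝ ∞ (fun p ↦ ∫ z, φ z (M (T z p)) ∂μ) :=
  contDiff_infty.2 fun N ↦ contDiff_nat_integral_comp_clm hT hρ hρm hTρ N hφ hint hM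

end ParametricIntegral

/-- The entire function `z ↦ cos √z`. -/
def cosSqrt (z : ℝ) : ℝ :=
  FormalMultilinearSeries.ofScalarsSum (E := ℝ) (fun k : ℕ ↦ (-1 : ℝ) ^ k / (2 * k).factorial) z

theorem cosSqrt_sq (s : ℝ) : cosSqrt (s ^ 2) = Real.cos s := by
  rw [cosSqrt, FormalMultilinearSeries.ofScalarsSum_eq_tsum]
  rw [← (Real.hasSum_cos s).tsum_eq]
  refine tsum_congr fun k ↦ ?_
  simp only [smul_eq_mul, ← pow_mul]
  ring

theorem contDiff_cosSqrt : ContDiff ℝ ∞ cosSqrt := by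
  have hr : (FormalMultilinearSeries.ofScalars ℝ
      (fun k : ℕ ↦ (-1 : ℝ) ^ k / (2 * k).factorial)).radius = ⊤ := by
    refine FormalMultilinearSeries.ofScalars_radius_eq_top_of_tendsto _ _
      (.of_forall fun k ↦ by positivity) ?_
    refine squeeze_zero (fun k ↦ by positivity) (fun k ↦ ?_)
      (tendsto_one_div_add_atTop_nhds_zero_nat (𝕜 := ℝ))
    have h : ((2 * (k + 1)).factorial : ℝ) = (2 * k + 2) * ((2 * k + 1) * (2 * k).factorial) := by
      rw [show 2 * (k + 1) = 2 * k + 1 + 1 by ring, Nat.factorial_succ, Nat.factorial_succ]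
      push_cast
      ring
    have hf : (0 : ℝ) < (2 * k).factorial := by positivity
    simp only [norm_div, norm_pow, norm_neg, norm_one, one_pow, Real.norm_natCast,
      Nat.succ_eq_add_one]
    rw [h, div_div_div_eq, one_mul, mul_one, div_le_div_iff₀ (by positivity) (by positivity)]
    have hk : (0 : ℝ) ≤ k := by positivity
    nlinarith [mul_nonneg hk hf.le, mul_nonneg (mul_nonneg hk hk) hf.le]
  have h := (FormalMultilinearSeries.ofScalars ℝ
    (fun k : ℕ ↦ (-1 : ℝ) ^ k / (2 * k).factorial)).hasFPowerSeriesOnBall (by simp [hr])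
  rw [hr] at h
  refine contDiff_iff_contDiffAt.2 fun x ↦ ?_
  exact (h.analyticAt_of_mem (by simp)).contDiffAt

theorem contDiff_iteratedDeriv_cosSqrt (k : ℕ) : ContDiff ℝ ∞ (iteratedDeriv k cosSqrt) := by
  rw [iteratedDeriv_eq_iterate]
  exact ContDiff.iterate_deriv k contDiff_cosSqrt

theorem hasDerivAt_iteratedDeriv_cosSqrt (k : ℕ) (z : ℝ) :
    HasDerivAt (iteratedDeriv k cosSqrt) (iteratedDeriv (k + 1) cosSqrt z) z := by
  rw [iteratedDeriv_succ]
  exact ((contDiff_iteratedDeriv_cosSqrt k).differentiable (by simp) z).hasDerivAt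

theorem mul_deriv_cosSqrt_sq (s : ℝ) : 2 * s * deriv cosSqrt (s ^ 2) = -Real.sin s := by
  have h1 : HasDerivAt (fun s ↦ cosSqrt (s ^ 2)) (deriv cosSqrt (s ^ 2) * (2 * s)) s := by
    have := (contDiff_cosSqrt.differentiable (by simp) (s ^ 2)).hasDerivAt.comp s
      (hasDerivAt_pow 2 s)
    simpa [Function.comp_def] using this
  simp only [cosSqrt_sq] at h1
  linarith [h1.unique (Real.hasDerivAt_cos s)]

theorem cosSqrt_ode (k : ℕ) : ∀ z : ℝ, 0 < z → 4 * z * iteratedDeriv (k + 2) cosSqrt z +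
    (4 * k + 2) * iteratedDeriv (k + 1) cosSqrt z + iteratedDeriv k cosSqrt z = 0 := by
  induction k with
  | zero =>
    intro z hz
    obtain ⟨s, hs, rfl⟩ : ∃ s : ℝ, 0 < s ∧ s ^ 2 = z := ⟨√z, by positivity, Real.sq_sqrt hz.le⟩
    have h1 : HasDerivAt (fun s ↦ 2 * s * iteratedDeriv 1 cosSqrt (s ^ 2))
        (2 * iteratedDeriv 1 cosSqrt (s ^ 2) +
          2 * s * (iteratedDeriv 2 cosSqrt (s ^ 2) * (2 * s))) s := by
      have h2 := (hasDerivAt_iteratedDeriv_cosSqrt 1 (s ^ 2)).comp s (hasDerivAt_pow 2 s)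
      have h3 := ((hasDerivAt_id s).const_mul 2).mul h2
      simpa [Function.comp_def, Pi.mul_def] using h3
    simp only [iteratedDeriv_one, mul_deriv_cosSqrt_sq] at h1
    have := h1.unique (Real.hasDerivAt_sin s).neg
    simp only [iteratedDeriv_zero, iteratedDeriv_one, cosSqrt_sq, zero_add]
    push_cast
    linarith
  | succ k ih =>
    intro z hz
    have h1 := ((((hasDerivAt_id z).const_mul 4).mul
      (hasDerivAt_iteratedDeriv_cosSqrt (k + 2) z)).add
      ((hasDerivAt_iteratedDeriv_cosSqrt (k + 1) z).const_mul (4 * (k : ℝ) + 2))).add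
      (hasDerivAt_iteratedDeriv_cosSqrt k z)
    have h2 := h1.congr_of_eventuallyEq (f₁ := fun _ ↦ 0)
      ((eventually_gt_nhds hz).mono fun y hy ↦ (ih y hy).symm)
    have h3 := h2.unique (hasDerivAt_const z 0)
    simp only [id] at h3
    push_cast
    linarith

theorem exists_bound_iteratedDeriv_cosSqrt (k : ℕ) :
    ∃ C, ∀ z : ℝ, 1 ≤ z → |iteratedDeriv k cosSqrt z| ≤ C := by
  induction k using Nat.twoStepInduction with
  | zero =>
    refine ⟨1, fun z hz ↦ ?_⟩
    rw [iteratedDeriv_zero, ← Real.sq_sqrt (zero_le_one.trans hz), cosSqrt_sq]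
    exact Real.abs_cos_le_one _
  | one =>
    refine ⟨1, fun z hz ↦ ?_⟩
    obtain ⟨s, hs, rfl⟩ : ∃ s : ℝ, 1 ≤ s ∧ s ^ 2 = z :=
      ⟨√z, Real.one_le_sqrt.2 hz, Real.sq_sqrt (by linarith)⟩
    have h1 := mul_deriv_cosSqrt_sq s
    have h2 := Real.abs_sin_le_one s
    rw [← abs_neg, ← h1, abs_mul, abs_of_pos (by linarith)] at h2
    rw [iteratedDeriv_one]
    nlinarith [abs_nonneg (deriv cosSqrt (s ^ 2))]
  | more k ih0 ih1 =>
    obtain ⟨C, hC⟩ := ih0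
    obtain ⟨D, hD⟩ := ih1
    refine ⟨(4 * k + 2) * D + C, fun z hz ↦ ?_⟩
    have h := cosSqrt_ode k z (by linarith)
    have h1 : |4 * z * iteratedDeriv (k + 2) cosSqrt z| ≤ (4 * k + 2) * D + C := by
      rw [show 4 * z * iteratedDeriv (k + 2) cosSqrt z =
        -((4 * k + 2) * iteratedDeriv (k + 1) cosSqrt z + iteratedDeriv k cosSqrt z) by linarith,
        abs_neg]
      refine (abs_add_le _ _).trans (add_le_add ?_ (hC z hz))
      rw [abs_mul, abs_of_nonneg (by positivity)]
      gcongr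
      exact hD z hz
    rw [abs_mul, abs_of_pos (by linarith)] at h1
    nlinarith [abs_nonneg (iteratedDeriv (k + 2) cosSqrt z)]

/-- A function equal to `cos √z` for `z ≥ 0`, all of whose derivatives are bounded. -/
def cosSqrtCut (z : ℝ) : ℝ := Real.smoothTransition (z + 2) * cosSqrt z

theorem cosSqrtCut_eq {z : ℝ} (hz : -1 ≤ z) : cosSqrtCut z = cosSqrt z := by
  rw [cosSqrtCut, Real.smoothTransition.one_of_one_le (by linarith), one_mul]

theorem cosSqrtCut_sq (s : ℝ) : cosSqrtCut (s ^ 2) = Real.cos s := by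
  rw [cosSqrtCut_eq (by nlinarith), cosSqrt_sq]

theorem hasTemperateGrowth_cosSqrtCut : cosSqrtCut.HasTemperateGrowth := by
  have hsm : ContDiff ℝ ∞ cosSqrtCut :=
    (Real.smoothTransition.contDiff.comp (contDiff_id.add contDiff_const)).mul contDiff_cosSqrt
  refine ⟨hsm, fun k ↦ ?_⟩
  obtain ⟨C, hC⟩ := exists_bound_iteratedDeriv_cosSqrt k
  have hcont : Continuous (iteratedDeriv k cosSqrtCut) :=
    hsm.continuous_iteratedDeriv k (mod_cast le_top)
  obtain ⟨D, hD⟩ := (isCompact_Icc (a := (-3 : ℝ)) (b := 1)).exists_bound_of_continuousOn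
    hcont.continuousOn
  refine ⟨0, max C D, fun z ↦ ?_⟩
  rw [norm_iteratedFDeriv_eq_norm_iteratedDeriv, pow_zero, mul_one]
  rcases le_total 1 z with h1 | h1
  · have : cosSqrtCut =ᶠ[𝓝 z] cosSqrt :=
      (eventually_gt_nhds (show (-1 : ℝ) < z by linarith)).mono fun y hy ↦ cosSqrtCut_eq hy.le
    rw [this.iteratedDeriv_eq]
    exact (hC z h1).trans (le_max_left _ _)
  rcases le_or_gt (-3) z with h2 | h2
  · exact (hD z ⟨h2, h1⟩).trans (le_max_right _ _)
  · have : cosSqrtCut =ᶠ[𝓝 z] fun _ ↦ 0 :=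
      (eventually_lt_nhds (show z < -2 by linarith)).mono fun y hy ↦ by
        rw [cosSqrtCut, Real.smoothTransition.zero_of_nonpos (by linarith), zero_mul]
    rw [this.iteratedDeriv_eq]
    have := (norm_nonneg _).trans (hD 0 (by simp))
    simp [this]

/-- A function of temperate growth with `s * L (s ^ 2) = sin s`. -/
def sincSqrtCut (z : ℝ) : ℝ := -2 * deriv cosSqrtCut z

theorem mul_sincSqrtCut_sq (s : ℝ) : s * sincSqrtCut (s ^ 2) = Real.sin s := by
  have : cosSqrtCut =ᶠ[𝓝 (s ^ 2)] cosSqrt :=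
    (eventually_gt_nhds (show (-1 : ℝ) < s ^ 2 by nlinarith)).mono fun y hy ↦ cosSqrtCut_eq hy.le
  rw [sincSqrtCut, this.deriv_eq]
  linarith [mul_deriv_cosSqrt_sq s]

theorem hasTemperateGrowth_sincSqrtCut : sincSqrtCut.HasTemperateGrowth := by
  have h := hasTemperateGrowth_fderiv hasTemperateGrowth_cosSqrtCut
  have h2 := ((-2 : ℝ) • ContinuousLinearMap.apply ℝ ℝ (1 : ℝ)).hasTemperateGrowth.comp h
  exact h2

theorem hasTemperateGrowth_cexp_I :
    (fun a : ℝ ↦ Complex.exp (Complex.I * a)).HasTemperateGrowth := by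
  have hsm : ContDiff ℝ ∞ (fun a : ℝ ↦ Complex.exp (Complex.I * a)) :=
    (contDiff_const.mul Complex.ofRealCLM.contDiff).cexp
  have h : ∀ k : ℕ, iteratedDeriv k (fun a : ℝ ↦ Complex.exp (Complex.I * a)) =
      fun a : ℝ ↦ Complex.I ^ k * Complex.exp (Complex.I * a) := by
    intro k
    induction k with
    | zero => simp
    | succ k ih =>
      rw [iteratedDeriv_succ, ih]
      funext a
      have h1 : HasDerivAt (fun a : ℝ ↦ Complex.I * (a : ℂ)) (Complex.I * 1) a :=
        (Complex.ofRealCLM.hasDerivAt (x := a)).const_mul Complex.I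
      rw [(h1.cexp.const_mul (Complex.I ^ k)).deriv]
      ring
  refine ⟨hsm, fun k ↦ ⟨0, 1, fun a ↦ ?_⟩⟩
  rw [norm_iteratedFDeriv_eq_norm_iteratedDeriv, h]
  simp [mul_comm Complex.I, Complex.norm_exp_ofReal_mul_I]

section FourierDecomposition

open MeasureTheory SchwartzMap
open scoped FourierTransform RealInnerProductSpace

variable {P E F V : Type} [NormedAddCommGroup P] [InnerProductSpace ℝ P] [FiniteDimensional ℝ P]
  [MeasurableSpace P] [BorelSpace P] [NormedAddCommGroup E] [NormedSpace ℝ E]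
  [NormedAddCommGroup F] [NormedSpace ℝ F] [NormedAddCommGroup V] [NormedSpace ℝ V]

theorem contDiff_integral_schwartz (Λ : P →L[ℝ] E →L[ℝ] F) (β : P →L[ℝ] ℝ) (N : E →L[ℝ] F)
    (S : 𝓢(P, ℂ)) {c : P → ℂ} (hc : Continuous c) {C : ℝ} (hcb : ∀ v, ‖c v‖ ≤ C * (1 + ‖v‖))
    {M : F → ℂ} (hM : M.HasTemperateGrowth) :
    ContDiff ℝ ∞ (fun p : E ↦ ∫ v, c v * S v * M (Λ v p + β v ^ 2 • N p)) := by
  set R : ℝ := 1 + ‖Λ‖ + ‖β‖ ^ 2 * ‖N‖ with hR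
  have hR1 : 1 ≤ R := by rw [hR, add_assoc]; exact le_add_of_nonneg_right (by positivity)
  have hφc : Continuous fun v ↦ ContinuousLinearMap.mul ℝ ℂ (c v * S v) :=
    (ContinuousLinearMap.mul ℝ ℂ).continuous.comp (hc.mul S.continuous)
  have hρc : Continuous fun v : P ↦ R * (1 + ‖v‖) ^ 2 := by fun_prop
  refine contDiff_integral_comp_clm (μ := volume) (T := fun v ↦ Λ v + β v ^ 2 • N)
    (ρ := fun v ↦ R * (1 + ‖v‖) ^ 2) (φ := fun v ↦ ContinuousLinearMap.mul ℝ ℂ (c v * S v))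
    (Continuous.aestronglyMeasurable (by fun_prop)) (fun v ↦ ?_)
    hρc.aestronglyMeasurable (fun v ↦ ?_)
    hφc.aestronglyMeasurable (fun k ↦ ?_) hM
  · have : 1 ≤ (1 + ‖v‖) ^ 2 := one_le_pow₀ (by simp)
    nlinarith
  · have h1 := Λ.le_opNorm v
    have h2 := β.le_opNorm v
    have h3 : ‖β v ^ 2 • N‖ ≤ (‖β‖ * ‖v‖) ^ 2 * ‖N‖ := by
      rw [norm_smul, norm_pow]; gcongr
    have hv := norm_nonneg v
    have h4 : 0 ≤ ‖β‖ ^ 2 * ‖N‖ := by positivity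
    calc ‖Λ v + β v ^ 2 • N‖ ≤ ‖Λ‖ * ‖v‖ + (‖β‖ * ‖v‖) ^ 2 * ‖N‖ :=
          (norm_add_le _ _).trans (add_le_add h1 h3)
      _ ≤ _ := by
        rw [hR]
        nlinarith [norm_nonneg Λ, mul_nonneg (norm_nonneg Λ) hv, mul_nonneg h4 hv,
          mul_nonneg (norm_nonneg Λ) (sq_nonneg ‖v‖)]
  · have hi : ∀ m : ℕ, Integrable (fun v ↦ (1 + ‖v‖) ^ m * ‖S v‖) (volume : Measure P) := by
      intro m
      have h1 : Integrable (fun v ↦ 2 ^ (m - 1) * (‖v‖ ^ 0 * ‖S v‖ + ‖v‖ ^ m * ‖S v‖)) volume :=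
        ((S.integrable_pow_mul volume 0).add (S.integrable_pow_mul volume m)).const_mul _
      refine h1.mono' (Continuous.aestronglyMeasurable ?_) (.of_forall fun v ↦ ?_)
      · have := S.continuous
        fun_prop
      · rw [Real.norm_of_nonneg (by positivity)]
        have := add_pow_le (zero_le_one) (norm_nonneg v) m
        calc _ ≤ (2 ^ (m - 1) * (1 ^ m + ‖v‖ ^ m)) * ‖S v‖ := by gcongr
          _ = _ := by rw [one_pow, pow_zero]; ring
    refine ((hi (2 * k + 1)).const_mul (R ^ k * C)).mono'
      ((hρc.pow k).mul hφc.norm).aestronglyMeasurable (.of_forall fun v ↦ ?_)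
    rw [norm_mul, norm_norm, ContinuousLinearMap.opNorm_mul_apply, norm_mul,
      Real.norm_of_nonneg (by positivity), mul_pow, ← pow_mul, pow_succ]
    calc _ ≤ R ^ k * (1 + ‖v‖) ^ (2 * k) * (C * (1 + ‖v‖) * ‖S v‖) := by gcongr; exact hcb v
      _ = _ := by ring

theorem exists_even_odd_of_hasCompactSupport [FiniteDimensional ℝ V] {f : V × ℝ → ℝ}
    (hf : ContDiff ℝ ∞ f) (hfc : HasCompactSupport f) :
    ∃ A B : V × ℝ → ℝ, ContDiff ℝ ∞ A ∧ ContDiff ℝ ∞ B ∧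
      ∀ x s, f (x, s) = A (x, s ^ 2) + s * B (x, s ^ 2) := by
  let Q := toEuclidean (E := V × ℝ)
  let P := EuclideanSpace ℝ (Fin (Module.finrank ℝ (V × ℝ)))
  let g : P → ℂ := fun w ↦ (f (Q.symm w) : ℂ)
  have hg : ContDiff ℝ ∞ g := Complex.ofRealCLM.contDiff.comp (hf.comp Q.symm.contDiff)
  have hgc : HasCompactSupport g :=
    (hfc.comp_homeomorph Q.symm.toHomeomorph).comp_left (g := fun a : ℝ ↦ (a : ℂ)) (by simp)
  let S : 𝓢(P, ℂ) := hgc.toSchwartzMap hg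
  let S' : 𝓢(P, ℂ) := 𝓕 S
  have hinv : ∀ w : P, (f (Q.symm w) : ℂ) =
      ∫ v, Complex.exp (Complex.I * (2 * Real.pi * ⟪v, w⟫ : ℝ)) * S' v := by
    intro w
    have h1 : 𝓕⁻ S' = S := FourierTransform.fourierInv_fourier_eq S
    have h2 : S w = 𝓕⁻ (S' : P → ℂ) w := by rw [← SchwartzMap.fourierInv_coe, h1]
    rw [Real.fourierInv_eq'] at h2
    simp only [smul_eq_mul, mul_comm _ Complex.I] at h2
    exact h2
  let I2 : P →L[ℝ] P →L[ℝ] ℝ := (2 * Real.pi) • innerSL ℝ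
  have hI2 : ∀ v w, I2 v w = 2 * Real.pi * ⟪v, w⟫ := fun v w ↦ by simp [I2]; rfl
  let Λ : P →L[ℝ] V × ℝ →L[ℝ] ℝ × ℝ :=
    (ContinuousLinearMap.compL ℝ (V × ℝ) ℝ (ℝ × ℝ) (ContinuousLinearMap.inl ℝ ℝ ℝ)).comp
      (((ContinuousLinearMap.compL ℝ (V × ℝ) P ℝ).flip
        (Q.toContinuousLinearMap.comp
          ((ContinuousLinearMap.inl ℝ V ℝ).comp (ContinuousLinearMap.fst ℝ V ℝ)))).comp I2)
  let β : P →L[ℝ] ℝ := I2.flip (Q (0, 1))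
  let N : V × ℝ →L[ℝ] ℝ × ℝ :=
    (ContinuousLinearMap.inr ℝ ℝ ℝ).comp (ContinuousLinearMap.snd ℝ V ℝ)
  have hT : ∀ v x r, Λ v (x, r) + β v ^ 2 • N (x, r) = (I2 v (Q (x, 0)), β v ^ 2 * r) := by
    intro v x r
    ext <;> simp [Λ, N]
  have hM : ∀ {K : ℝ → ℝ}, K.HasTemperateGrowth →
      (fun y : ℝ × ℝ ↦ Complex.exp (Complex.I * y.1) * (K y.2 : ℂ)).HasTemperateGrowth := by
    intro K hK
    have h1 := hasTemperateGrowth_cexp_I.comp (ContinuousLinearMap.fst ℝ ℝ ℝ).hasTemperateGrowth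
    have h2 := Complex.ofRealCLM.hasTemperateGrowth.comp
      (hK.comp (ContinuousLinearMap.snd ℝ ℝ ℝ).hasTemperateGrowth)
    exact h1.mul h2
  have hA := contDiff_integral_schwartz Λ β N S' (c := fun _ ↦ 1) (C := 1) continuous_const
    (fun v ↦ by simp; exact norm_nonneg v) (hM hasTemperateGrowth_cosSqrtCut)
  have hB := contDiff_integral_schwartz Λ β N S' (c := fun v ↦ Complex.I * β v) (C := ‖β‖)
    (by fun_prop) (fun v ↦ by
      rw [norm_mul, Complex.norm_I, one_mul, Complex.norm_real]
      exact (β.le_opNorm v).trans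
        (mul_le_mul_of_nonneg_left (by linarith) (norm_nonneg β)))
        (hM hasTemperateGrowth_sincSqrtCut)
  refine ⟨_, _, Complex.reCLM.contDiff.comp hA, Complex.reCLM.contDiff.comp hB, fun x s ↦ ?_⟩
  have hpt : ∀ v : P, Complex.exp (Complex.I * (2 * Real.pi * ⟪v, Q (x, s)⟫ : ℝ)) * S' v =
      1 * S' v * (Complex.exp (Complex.I * (I2 v (Q (x, 0)) : ℝ)) *
        (cosSqrtCut (β v ^ 2 * s ^ 2) : ℂ)) +
      s * (Complex.I * β v * S' v * (Complex.exp (Complex.I * (I2 v (Q (x, 0)) : ℝ)) *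
        (sincSqrtCut (β v ^ 2 * s ^ 2) : ℂ))) := by
    intro v
    have h1 : 2 * Real.pi * ⟪v, Q (x, s)⟫ = I2 v (Q (x, 0)) + s * β v := by
      rw [← hI2, show (x, s) = (x, 0) + s • ((0 : V), (1 : ℝ)) by simp, map_add, map_add, map_smul,
        map_smul]
      rfl
    have h2 := mul_sincSqrtCut_sq (s * β v)
    have h3 : (Real.sin (s * β v) : ℂ) = s * β v * sincSqrtCut ((s * β v) ^ 2) := by
      rw [← h2]; push_cast; ring
    rw [h1, ← mul_pow, mul_comm (β v) s, cosSqrtCut_sq, Complex.ofReal_add, mul_add,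
      Complex.exp_add, mul_comm Complex.I ((s * β v : ℝ) : ℂ), Complex.exp_mul_I,
      ← Complex.ofReal_cos, ← Complex.ofReal_sin, h3]
    ring
  have hS'c : Continuous S' := S'.continuous
  have hcosc : Continuous cosSqrtCut := hasTemperateGrowth_cosSqrtCut.1.continuous
  have hsinc : Continuous sincSqrtCut := hasTemperateGrowth_sincSqrtCut.1.continuous
  have hint1 : Integrable (fun v : P ↦ 1 * S' v *
      (Complex.exp (Complex.I * (I2 v (Q (x, 0)) : ℝ)) * (cosSqrtCut (β v ^ 2 * s ^ 2) : ℂ))) := by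
    refine S'.integrable.norm.mono' (Continuous.aestronglyMeasurable (by fun_prop))
      (.of_forall fun v ↦ ?_)
    rw [← mul_pow, cosSqrtCut_sq, one_mul, norm_mul, norm_mul, mul_comm Complex.I,
      Complex.norm_exp_ofReal_mul_I, one_mul, Complex.norm_real]
    exact mul_le_of_le_one_right (norm_nonneg _) (Real.abs_cos_le_one _)
  have hint0 : Integrable (fun v : P ↦
      Complex.exp (Complex.I * (2 * Real.pi * ⟪v, Q (x, s)⟫ : ℝ)) * S' v) := by
    refine S'.integrable.norm.mono' (Continuous.aestronglyMeasurable (by fun_prop))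
      (.of_forall fun v ↦ ?_)
    rw [norm_mul, mul_comm Complex.I, Complex.norm_exp_ofReal_mul_I, one_mul]
  have h := hinv (Q (x, s))
  have hint2 := hint0.sub hint1
  have key : (f (x, s) : ℂ) =
      (∫ v, 1 * S' v * (Complex.exp (Complex.I * (I2 v (Q (x, 0)) : ℝ)) *
        (cosSqrtCut (β v ^ 2 * s ^ 2) : ℂ))) +
      s * ∫ v, Complex.I * β v * S' v * (Complex.exp (Complex.I * (I2 v (Q (x, 0)) : ℝ)) *
        (sincSqrtCut (β v ^ 2 * s ^ 2) : ℂ)) := by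
    rw [← integral_const_mul, ← integral_add hint1]
    · rw [Q.symm_apply_apply] at h
      rw [h]
      exact integral_congr_ae (.of_forall hpt)
    · refine hint2.congr (.of_forall fun v ↦ ?_)
      simp only [Pi.sub_apply, hpt v, add_sub_cancel_left]
  have := congrArg Complex.re key
  simp only [Function.comp_apply, hT]
  simpa using this

end FourierDecomposition

/-- Smoothness on a neighbourhood of a point. -/
def SmoothNear {E F : Type} [NormedAddCommGroup E] [NormedSpace ℝ E] [NormedAddCommGroup F]
    [NormedSpace ℝ F] (f : E → F) (x : E) : Prop :=
  ∀ᶠ y in 𝓝 x, ContDiffAt ℝ ∞ f y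

namespace SmoothNear

variable {E F G : Type} [NormedAddCommGroup E] [NormedSpace ℝ E] [NormedAddCommGroup F]
  [NormedSpace ℝ F] [NormedAddCommGroup G] [NormedSpace ℝ G] {x : E}

theorem contDiffAt {f : E → F} (hf : SmoothNear f x) : ContDiffAt ℝ ∞ f x := hf.self_of_nhds

theorem continuousAt {f : E → F} (hf : SmoothNear f x) : ContinuousAt f x :=
  hf.contDiffAt.continuousAt

theorem differentiableAt {f : E → F} (hf : SmoothNear f x) : DifferentiableAt ℝ f x :=
  hf.contDiffAt.differentiableAt (by simp)

theorem _root_.ContDiff.smoothNear {f : E → F} (hf : ContDiff ℝ ∞ f) : SmoothNear f x :=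
  .of_forall fun _ ↦ hf.contDiffAt

theorem comp {g : F → G} {f : E → F} (hg : SmoothNear g (f x)) (hf : SmoothNear f x) :
    SmoothNear (fun y ↦ g (f y)) x := by
  filter_upwards [hf, hf.continuousAt.eventually hg] with y h1 h2 using h2.comp y h1

theorem add {f g : E → F} (hf : SmoothNear f x) (hg : SmoothNear g x) :
    SmoothNear (fun y ↦ f y + g y) x := by
  filter_upwards [hf, hg] with y h1 h2 using h1.add h2

theorem sub {f g : E → F} (hf : SmoothNear f x) (hg : SmoothNear g x) :
    SmoothNear (fun y ↦ f y - g y) x := by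
  filter_upwards [hf, hg] with y h1 h2 using h1.sub h2

theorem mul {f g : E → ℝ} (hf : SmoothNear f x) (hg : SmoothNear g x) :
    SmoothNear (fun y ↦ f y * g y) x := by
  filter_upwards [hf, hg] with y h1 h2 using h1.mul h2

theorem prodMk {f : E → F} {g : E → G} (hf : SmoothNear f x) (hg : SmoothNear g x) :
    SmoothNear (fun y ↦ (f y, g y)) x := by
  filter_upwards [hf, hg] with y h1 h2 using h1.prodMk h2

theorem pi {ι : Type} [Fintype ι] {f : E → ι → ℝ} (hf : ∀ i, SmoothNear (fun y ↦ f y i) x) :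
    SmoothNear f x := by
  filter_upwards [eventually_all.2 hf] with y h1 using contDiffAt_pi.2 h1

theorem fst {f : E → F × G} (hf : SmoothNear f x) : SmoothNear (fun y ↦ (f y).1) x := by
  filter_upwards [hf] with y h1 using h1.fst

theorem snd {f : E → F × G} (hf : SmoothNear f x) : SmoothNear (fun y ↦ (f y).2) x := by
  filter_upwards [hf] with y h1 using h1.snd

theorem apply {ι : Type} [Fintype ι] {f : E → ι → ℝ} (hf : SmoothNear f x) (i : ι) :
    SmoothNear (fun y ↦ f y i) x := by
  filter_upwards [hf] with y h1 using contDiffAt_pi.1 h1 i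

theorem fderiv_apply {f : E → F} (hf : SmoothNear f x) (v : E) :
    SmoothNear (fun y ↦ fderiv ℝ f y v) x := by
  filter_upwards [hf] with y h1
  exact (h1.fderiv_right (m := ∞) (by simp)).clm_apply contDiffAt_const

theorem sqrt {f : E → ℝ} (hf : SmoothNear f x) (h0 : f x ≠ 0) :
    SmoothNear (fun y ↦ √(f y)) x := by
  filter_upwards [hf, hf.continuousAt.eventually_ne h0] with y h1 h2 using h1.sqrt h2

theorem congr {f g : E → F} (hf : SmoothNear f x) (h : g =ᶠ[𝓝 x] f) : SmoothNear g x := by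
  filter_upwards [hf, h.eventuallyEq_nhds] with y h1 h2 using h1.congr_of_eventuallyEq h2

theorem exists_localInverse [CompleteSpace E] {f : E → F} {e : E ≃L[ℝ] F} (hf : SmoothNear f x)
    (hd : HasFDerivAt f (e : E →L[ℝ] F) x) :
    ∃ g : F → E, SmoothNear g (f x) ∧ g (f x) = x ∧ HasFDerivAt g (e.symm : F →L[ℝ] E) (f x) ∧
      (∀ᶠ y in 𝓝 x, g (f y) = y) ∧ ∀ᶠ z in 𝓝 (f x), f (g z) = z := by
  have hs : HasStrictFDerivAt f (e : E →L[ℝ] F) x := hf.contDiffAt.hasStrictFDerivAt' hd (by simp)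
  have hgx : hs.localInverse f e x (f x) = x := hs.localInverse_apply_image
  refine ⟨hs.localInverse f e x, ?_, hgx, hs.to_localInverse.hasFDerivAt,
    hs.eventually_left_inverse, hs.eventually_right_inverse⟩
  have hcont : ContinuousAt (hs.localInverse f e x) (f x) := hs.localInverse_continuousAt
  have hinv : ∀ᶠ y in 𝓝 x, ∃ e' : E ≃L[ℝ] F, (e' : E →L[ℝ] F) = fderiv ℝ f y := by
    have h1 : ContinuousAt (fderiv ℝ f) x :=
      (hf.contDiffAt.fderiv_right (m := ∞) (by simp)).continuousAt
    exact h1.eventually (hd.fderiv ▸ e.nhds)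
  have hopen : ∀ᶠ z in 𝓝 (f x), z ∈ (hs.toOpenPartialHomeomorph f).target :=
    (hs.toOpenPartialHomeomorph f).open_target.mem_nhds hs.image_mem_toOpenPartialHomeomorph_target
  have hgx' := hcont.tendsto
  rw [hgx] at hgx'
  filter_upwards [hopen, hgx'.eventually hinv, hgx'.eventually hf] with z h1 ⟨e', h2⟩ h3
  refine (hs.toOpenPartialHomeomorph f).contDiffAt_symm (f₀' := e') h1 ?_ h3
  rw [h2]
  exact (h3.differentiableAt (by simp)).hasFDerivAt

theorem exists_hasCompactSupport [FiniteDimensional ℝ E] {f : E → ℝ} (hf : SmoothNear f x) :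
    ∃ g : E → ℝ, ContDiff ℝ ∞ g ∧ HasCompactSupport g ∧ g =ᶠ[𝓝 x] f := by
  obtain ⟨r, hr, h⟩ := Metric.eventually_nhds_iff_ball.1 hf
  let b : ContDiffBump x := ⟨r / 4, r / 2, by positivity, by linarith⟩
  refine ⟨fun y ↦ b y * f y, ?_, b.hasCompactSupport.mul_right, ?_⟩
  · refine contDiff_iff_contDiffAt.2 fun y ↦ ?_
    by_cases hy : y ∈ tsupport (fun y ↦ b y * f y)
    swap
    · exact contDiffAt_const.congr_of_eventuallyEq (notMem_tsupport_iff_eventuallyEq.1 hy)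
    have h1 : y ∈ tsupport b := tsupport_mul_subset_left hy
    rw [b.tsupport_eq] at h1
    refine b.contDiff.contDiffAt.mul (h y ?_)
    exact Metric.closedBall_subset_ball (show r / 2 < r by linarith) h1
  · filter_upwards [b.eventuallyEq_one] with y hy
    simp [hy]

end SmoothNear

section Division

open MeasureTheory

variable {V : Type} [NormedAddCommGroup V] [NormedSpace ℝ V] [FiniteDimensional ℝ V]

theorem hadamard_of_hasCompactSupport {f : V × ℝ → ℝ} (hf : ContDiff ℝ ∞ f)
    (hfc : HasCompactSupport f) :
    ∃ g : V × ℝ → ℝ, ContDiff ℝ ∞ g ∧ ∀ p, f p - f (p.1, 0) = p.2 * g p := by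
  let T : ℝ → V × ℝ →L[ℝ] V × ℝ := fun τ ↦
    (ContinuousLinearMap.fst ℝ V ℝ).prod (max 0 (min 1 τ) • ContinuousLinearMap.snd ℝ V ℝ)
  have hTc : Continuous T := by
    have h : Continuous fun τ : ℝ ↦ max 0 (min 1 τ) • ContinuousLinearMap.snd ℝ V ℝ := by fun_prop
    have : T = fun τ ↦ ContinuousLinearMap.prodₗᵢ ℝ
      (ContinuousLinearMap.fst ℝ V ℝ, max 0 (min 1 τ) • ContinuousLinearMap.snd ℝ V ℝ) := rfl
    rw [this]
    exact (ContinuousLinearMap.prodₗᵢ ℝ).continuous.comp (continuous_const.prodMk h)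
  have hT1 : ∀ τ, ‖T τ‖ ≤ 1 := fun τ ↦ by
    refine ContinuousLinearMap.opNorm_le_bound _ zero_le_one fun p ↦ ?_
    have h2 : |max 0 (min 1 τ)| ≤ 1 := by
      rw [abs_of_nonneg (le_max_left _ _)]; simp
    rw [one_mul]
    refine max_le (norm_fst_le p) ?_
    have h3 : ‖(T τ p).2‖ = |max 0 (min 1 τ)| * ‖p.2‖ := by
      simp only [T, ContinuousLinearMap.prod_apply, _root_.smul_apply,
        ContinuousLinearMap.coe_snd', norm_smul, Real.norm_eq_abs]
    rw [h3]
    exact (mul_le_of_le_one_left (norm_nonneg _) h2).trans (norm_snd_le p)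
  have hM : (fun p : V × ℝ ↦ fderiv ℝ f p (0, 1)).HasTemperateGrowth := by
    refine HasCompactSupport.hasTemperateGrowth ?_ ?_
    · exact (hfc.fderiv ℝ).comp_left (g := fun A : V × ℝ →L[ℝ] ℝ ↦ A (0, 1)) rfl
    · exact (hf.fderiv_right (m := ∞) (by simp)).clm_apply contDiff_const
  refine ⟨_, contDiff_integral_comp_clm (μ := volume.restrict (Set.Ioc (0 : ℝ) 1)) (T := T)
    (ρ := fun _ ↦ 1) (φ := fun _ ↦ ContinuousLinearMap.id ℝ ℝ) hTc.aestronglyMeasurable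
    (fun _ ↦ le_rfl) aestronglyMeasurable_const hT1 aestronglyMeasurable_const
    (fun k ↦ integrable_const _) hM, fun p ↦ ?_⟩
  rw [← intervalIntegral.integral_of_le zero_le_one, ← intervalIntegral.integral_const_mul]
  have hderiv : ∀ τ : ℝ, HasDerivAt (fun τ ↦ f (p.1, τ * p.2))
      (p.2 * fderiv ℝ f (p.1, τ * p.2) (0, 1)) τ := fun τ ↦ by
    have h1 : HasDerivAt (fun τ : ℝ ↦ (p.1, τ * p.2)) (0, 1 * p.2) τ :=
      (hasDerivAt_const τ p.1).prodMk ((hasDerivAt_id τ).mul_const p.2)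
    have h2 := (hf.differentiable (by simp) (p.1, τ * p.2)).hasFDerivAt.comp_hasDerivAt τ h1
    refine h2.congr_deriv ?_
    rw [show ((0 : V), 1 * p.2) = p.2 • ((0 : V), (1 : ℝ)) by simp, map_smul, smul_eq_mul]
  have h := intervalIntegral.integral_eq_sub_of_hasDerivAt (a := 0) (b := 1)
    (fun τ _ ↦ hderiv τ) ?_
  · rw [one_mul, zero_mul] at h
    rw [← h]
    refine intervalIntegral.integral_congr fun τ hτ ↦ ?_
    rw [Set.uIcc_of_le zero_le_one] at hτ
    have : T τ p = (p.1, τ * p.2) := by simp [T, hτ.1, hτ.2]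
    simp [this]
  · refine Continuous.intervalIntegrable ?_ _ _
    have h1 := hM.1.continuous
    exact continuous_const.mul (h1.comp (by fun_prop : Continuous fun τ : ℝ ↦ (p.1, τ * p.2)))

/-- Hadamard's lemma. -/
theorem SmoothNear.hadamard {f : V × ℝ → ℝ} (hf : SmoothNear f 0) :
    ∃ g : V × ℝ → ℝ, ContDiff ℝ ∞ g ∧ ∀ᶠ p in 𝓝 0, f p - f (p.1, 0) = p.2 * g p := by
  obtain ⟨f', h1, h2, h3⟩ := hf.exists_hasCompactSupport
  obtain ⟨g, hg, h⟩ := hadamard_of_hasCompactSupport h1 h2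
  have h4 : Tendsto (fun p : V × ℝ ↦ (p.1, (0 : ℝ))) (𝓝 0) (𝓝 0) :=
    Continuous.tendsto' (by fun_prop) _ _ rfl
  exact ⟨g, hg, by filter_upwards [h3, h4.eventually h3] with p h5 h6; rw [← h5, ← h6, h]⟩

/-- Whitney's decomposition into even and odd parts in the last variable. -/
theorem SmoothNear.exists_even_odd {ι : Type} [Fintype ι] {f : V × ℝ → ι → ℝ}
    (hf : SmoothNear f 0) :
    ∃ A B : V × ℝ → ι → ℝ, ContDiff ℝ ∞ A ∧ ContDiff ℝ ∞ B ∧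
      ∀ᶠ p in 𝓝 0, f p = A (p.1, p.2 ^ 2) + p.2 • B (p.1, p.2 ^ 2) := by
  have : ∀ i, ∃ A B : V × ℝ → ℝ, ContDiff ℝ ∞ A ∧ ContDiff ℝ ∞ B ∧
      ∀ᶠ p in 𝓝 0, f p i = A (p.1, p.2 ^ 2) + p.2 * B (p.1, p.2 ^ 2) := fun i ↦ by
    obtain ⟨f', h1, h2, h3⟩ := (hf.apply i).exists_hasCompactSupport
    obtain ⟨A, B, hA, hB, h⟩ := exists_even_odd_of_hasCompactSupport h1 h2
    exact ⟨A, B, hA, hB, h3.mono fun p hp ↦ by rw [← h]; exact hp.symm⟩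
  choose A B hA hB h using this
  refine ⟨fun p i ↦ A i p, fun p i ↦ B i p, contDiff_pi.2 hA, contDiff_pi.2 hB, ?_⟩
  filter_upwards [eventually_all.2 h] with p hp
  ext i
  simpa using hp i

end Division

theorem eventually_eventually_fiber {V : Type} [TopologicalSpace V] [Zero V]
    {P : V × ℝ → Prop} (h : ∀ᶠ p in 𝓝 0, P p) :
    ∀ᶠ x in 𝓝 (0 : V), ∀ᶠ t in 𝓝 (0 : ℝ), P (x, t) := by
  have h1 : Tendsto (fun x : V ↦ (x, (0 : ℝ))) (𝓝 0) (𝓝 0) :=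
    Continuous.tendsto' (by fun_prop) _ _ rfl
  filter_upwards [h1.eventually h.eventually_nhds] with x hx
  have h2 : Tendsto (fun t : ℝ ↦ (x, t)) (𝓝 0) (𝓝 (x, 0)) :=
    Continuous.tendsto' (by fun_prop) _ _ rfl
  exact h2.eventually hx

section NormalForm

variable {V : Type} [NormedAddCommGroup V] [NormedSpace ℝ V]

theorem hasDerivAt_smul_of_continuousAt {F : Type} [NormedAddCommGroup F] [NormedSpace ℝ F]
    {w : ℝ → F} (hw : ContinuousAt w 0) :
    HasDerivAt (fun t ↦ t • w t) (w 0) 0 := by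
  rw [hasDerivAt_iff_tendsto_slope]
  refine (hw.tendsto.mono_left nhdsWithin_le_nhds).congr' ?_
  filter_upwards [self_mem_nhdsWithin] with t (ht : t ≠ 0)
  simp [slope_def_module, smul_smul, inv_mul_cancel₀ ht]

/-- The linear form `(x, t) ↦ α x + c t`. -/
def prodForm (α : V →L[ℝ] ℝ) (c : ℝ) : V × ℝ →L[ℝ] ℝ :=
  α.comp (ContinuousLinearMap.fst ℝ V ℝ) + c • ContinuousLinearMap.snd ℝ V ℝ

@[simp]
theorem prodForm_apply (α : V →L[ℝ] ℝ) (c : ℝ) (p : V × ℝ) :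
    prodForm α c p = α p.1 + c * p.2 := by
  simp [prodForm]

/-- The linear equivalence `(x, t) ↦ (x, α x + c t)`. -/
def shear (α : V →L[ℝ] ℝ) (c : ℝ) (hc : c ≠ 0) : (V × ℝ) ≃L[ℝ] (V × ℝ) :=
  ContinuousLinearEquiv.equivOfInverse
    ((ContinuousLinearMap.fst ℝ V ℝ).prod (prodForm α c))
    ((ContinuousLinearMap.fst ℝ V ℝ).prod (prodForm (-(c⁻¹ • α)) c⁻¹))
    (fun p ↦ by ext <;> simp; field_simp; ring) (fun p ↦ by ext <;> simp; field_simp; ring)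

theorem SmoothNear.exists_fiberInverse [CompleteSpace V] {S : V × ℝ → ℝ} (hS : SmoothNear S 0)
    (h0 : S 0 = 0) {α : V →L[ℝ] ℝ} {c : ℝ} (hc : c ≠ 0) (hd : HasFDerivAt S (prodForm α c) 0) :
    ∃ T : V × ℝ → ℝ, SmoothNear T 0 ∧ T 0 = 0 ∧
      HasFDerivAt T (prodForm (-(c⁻¹ • α)) c⁻¹) 0 ∧
      (∀ᶠ p in 𝓝 0, S (p.1, T p) = p.2) ∧ ∀ᶠ p in 𝓝 0, T (p.1, S p) = p.2 := by
  have h1 : SmoothNear (fun p : V × ℝ ↦ (p.1, S p)) 0 := contDiff_fst.smoothNear.prodMk hS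
  have h2 : HasFDerivAt (fun p : V × ℝ ↦ (p.1, S p)) (shear α c hc : V × ℝ →L[ℝ] V × ℝ) 0 :=
    hasFDerivAt_fst.prodMk hd
  obtain ⟨g, hg, hg0, hgd, hl, hr⟩ := h1.exists_localInverse h2
  have h3 : ((0 : V × ℝ).1, S 0) = 0 := by rw [h0]; rfl
  rw [h3] at hg hg0 hgd hr
  refine ⟨fun p ↦ (g p).2, hg.snd, congrArg Prod.snd hg0, hgd.snd, ?_, ?_⟩
  · filter_upwards [hr] with p hp
    obtain ⟨h4, h5⟩ := Prod.ext_iff.1 hp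
    rw [← h4]
    exact h5
  · filter_upwards [hl] with p hp
    rw [hp]

theorem hasDerivAt_fiber {F : Type} [NormedAddCommGroup F] [NormedSpace ℝ F] {f : V × ℝ → F}
    {x : V} {t : ℝ} (hf : DifferentiableAt ℝ f (x, t)) :
    HasDerivAt (fun s ↦ f (x, s)) (fderiv ℝ f (x, t) (0, 1)) t :=
  hf.hasFDerivAt.comp_hasDerivAt t ((hasDerivAt_const t x).prodMk (hasDerivAt_id t))

/-- A Morse lemma with parameters, in one variable. -/
theorem SmoothNear.exists_morse [FiniteDimensional ℝ V] {k : V × ℝ → ℝ} (hk : SmoothNear k 0)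
    (h0 : fderiv ℝ k 0 (0, 1) = 0) {α : V →L[ℝ] ℝ}
    (hd : HasFDerivAt (fun p ↦ fderiv ℝ k p (0, 1)) (prodForm α 2) 0) :
    ∃ (c : V → ℝ) (S : V × ℝ → ℝ), SmoothNear c 0 ∧ SmoothNear S 0 ∧ c 0 = k 0 ∧ S 0 = 0 ∧
      HasFDerivAt S (prodForm ((2⁻¹ : ℝ) • α) 1) 0 ∧ ∀ᶠ p in 𝓝 0, k p = c p.1 + S p ^ 2 := by
  have : CompleteSpace V := FiniteDimensional.complete ℝ V
  obtain ⟨T, hT, hT0, hTd, hT1, -⟩ :=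
    (hk.fderiv_apply (0, 1)).exists_fiberInverse h0 two_ne_zero hd
  have hι : Tendsto (fun x : V ↦ (x, (0 : ℝ))) (𝓝 0) (𝓝 0) :=
    Continuous.tendsto' (by fun_prop) _ _ rfl
  have hιs : SmoothNear (fun x : V ↦ (x, (0 : ℝ))) 0 :=
    (contDiff_id.prodMk contDiff_const).smoothNear
  have hιd : HasFDerivAt (fun x : V ↦ (x, (0 : ℝ))) (ContinuousLinearMap.inl ℝ V ℝ) 0 :=
    (ContinuousLinearMap.inl ℝ V ℝ).hasFDerivAt
  let θ : V → ℝ := fun x ↦ T (x, 0)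
  have hθ : SmoothNear θ 0 := SmoothNear.comp (g := T) hT hιs
  have hθ0 : θ 0 = 0 := hT0
  have hθd : HasFDerivAt θ (-((2⁻¹ : ℝ) • α)) 0 := by
    refine (HasFDerivAt.comp (g := T) (f := fun x : V ↦ (x, (0 : ℝ))) 0 hTd hιd).congr_fderiv ?_
    ext x
    simp
  have hkθ : ∀ᶠ x in 𝓝 (0 : V), fderiv ℝ k (x, θ x) (0, 1) = 0 := hι.eventually hT1
  have hθ1 : SmoothNear (fun p : V × ℝ ↦ θ p.1) 0 :=
    SmoothNear.comp (g := θ) (f := Prod.fst) hθ contDiff_fst.smoothNear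
  have hkc : SmoothNear (fun x ↦ k (x, θ x)) 0 := by
    refine SmoothNear.comp (g := k) (f := fun x ↦ (x, θ x)) ?_ (contDiff_id.smoothNear.prodMk hθ)
    rwa [hθ0]
  let f : V × ℝ → ℝ := fun p ↦ k (p.1, p.2 + θ p.1) - k (p.1, θ p.1)
  have hf : SmoothNear f 0 := by
    refine SmoothNear.sub (SmoothNear.comp (g := k) (f := fun p : V × ℝ ↦ (p.1, p.2 + θ p.1)) ?_
      (contDiff_fst.smoothNear.prodMk (contDiff_snd.smoothNear.add hθ1)))
      (SmoothNear.comp (g := fun x ↦ k (x, θ x)) (f := Prod.fst) hkc contDiff_fst.smoothNear)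
    simpa [hθ0, Prod.mk_zero_zero] using hk
  have hf0 : ∀ x, f (x, 0) = 0 := fun x ↦ by simp [f]
  obtain ⟨g, hg, hfg⟩ := hf.hadamard
  obtain ⟨m, hm, hgm⟩ := (hg.smoothNear (x := 0)).hadamard
  have hkd : ∀ᶠ p in 𝓝 (0 : V × ℝ), DifferentiableAt ℝ k p := by
    filter_upwards [hk] with p hp using hp.differentiableAt (by simp)
  have hfd : ∀ᶠ p in 𝓝 (0 : V × ℝ), HasDerivAt (fun t ↦ f (p.1, t))
      (fderiv ℝ k (p.1, p.2 + θ p.1) (0, 1)) p.2 := by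
    have h1 : Tendsto (fun p : V × ℝ ↦ (p.1, p.2 + θ p.1)) (𝓝 0) (𝓝 0) := by
      have : ContinuousAt (fun p : V × ℝ ↦ (p.1, p.2 + θ p.1)) 0 :=
        continuousAt_fst.prodMk (continuousAt_snd.add hθ1.continuousAt)
      simpa [ContinuousAt, hθ0, Prod.mk_zero_zero] using this
    filter_upwards [h1.eventually hkd] with p hp
    exact ((hasDerivAt_fiber hp).comp_add_const p.2 (θ p.1)).sub_const (k (p.1, θ p.1))
  have hg0 : ∀ᶠ x in 𝓝 (0 : V), g (x, 0) = 0 := by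
    filter_upwards [eventually_eventually_fiber hfg, hι.eventually hfd, hkθ] with x h1 h2 h3
    have h4 : HasDerivAt (fun t ↦ t • g (x, t)) (g (x, 0)) 0 :=
      hasDerivAt_smul_of_continuousAt (w := fun t ↦ g (x, t))
        (hg.continuous.comp (by fun_prop : Continuous fun t : ℝ ↦ (x, t))).continuousAt
    have h5 := h4.congr_of_eventuallyEq (f₁ := fun t ↦ f (x, t)) (by
      filter_upwards [h1] with t ht
      simpa [hf0] using ht)
    rw [h5.unique h2, zero_add, h3]
  have hfm : ∀ᶠ p in 𝓝 (0 : V × ℝ), f p = p.2 ^ 2 * m p := by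
    filter_upwards [hfg, hgm, continuousAt_fst.eventually hg0] with p h1 h2 h3
    rw [hf0, sub_zero] at h1
    rw [h3, sub_zero] at h2
    rw [h1, h2]
    ring
  have hm0 : m 0 = 1 := by
    have h1 : ∀ᶠ t in 𝓝 (0 : ℝ), fderiv ℝ k (0, t) (0, 1) =
        t • (2 * m (0, t) + t * fderiv ℝ m (0, t) (0, 1)) := by
      have hι' : Tendsto (fun t : ℝ ↦ ((0 : V), t)) (𝓝 0) (𝓝 0) :=
        Continuous.tendsto' (by fun_prop) _ _ rfl
      filter_upwards [(hι'.eventually hfm).eventually_nhds, hι'.eventually hfd] with t h1 h2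
      have h3 := (hasDerivAt_pow 2 t).mul
        (hasDerivAt_fiber (x := (0 : V)) (t := t) (hm.differentiable (by simp) _))
      have h4 := (h3.congr_of_eventuallyEq h1).unique h2
      simp only [hθ0, add_zero] at h4
      rw [← h4, smul_eq_mul]
      simp
      ring
    have h2 : HasDerivAt (fun t : ℝ ↦ fderiv ℝ k ((0 : V), t) (0, 1)) 2 0 := by
      have := HasFDerivAt.comp_hasDerivAt (0 : ℝ) hd
        ((hasDerivAt_const (0 : ℝ) (0 : V)).prodMk (hasDerivAt_id (0 : ℝ)))
      simpa [Function.comp_def] using this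
    have hmc : Continuous fun t : ℝ ↦ 2 * m ((0 : V), t) + t * fderiv ℝ m (0, t) (0, 1) := by
      have h3 := hm.continuous
      have h4 := ((hm.fderiv_right (m := ∞) (by simp)).clm_apply
        (contDiff_const (c := ((0 : V), (1 : ℝ))))).continuous
      have h5 : Continuous fun t : ℝ ↦ ((0 : V), t) := by fun_prop
      exact (continuous_const.mul (h3.comp h5)).add (continuous_id.mul (h4.comp h5))
    have h3 := (hasDerivAt_smul_of_continuousAt hmc.continuousAt).congr_of_eventuallyEq h1
    have h4 := h3.unique h2
    simp only [zero_mul, add_zero] at h4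
    have : m ((0 : V), (0 : ℝ)) = 1 := by linarith
    exact this
  have hshift : Tendsto (fun p : V × ℝ ↦ (p.1, p.2 - θ p.1)) (𝓝 0) (𝓝 0) := by
    have : ContinuousAt (fun p : V × ℝ ↦ (p.1, p.2 - θ p.1)) 0 :=
      continuousAt_fst.prodMk (continuousAt_snd.sub hθ1.continuousAt)
    simpa [ContinuousAt, hθ0, Prod.mk_zero_zero] using this
  have hsub : SmoothNear (fun p : V × ℝ ↦ p.2 - θ p.1) 0 := contDiff_snd.smoothNear.sub hθ1
  have hroot : SmoothNear (fun p : V × ℝ ↦ √(m (p.1, p.2 - θ p.1))) 0 := by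
    refine SmoothNear.sqrt (SmoothNear.comp (g := m) hm.smoothNear
      (contDiff_fst.smoothNear.prodMk hsub)) ?_
    have : m ((0 : V), 0 - θ 0) = 1 := by rw [hθ0, sub_zero]; exact hm0
    simpa using this.trans_ne one_ne_zero
  refine ⟨fun x ↦ k (x, θ x), fun p ↦ (p.2 - θ p.1) * √(m (p.1, p.2 - θ p.1)), hkc,
    hsub.mul hroot, congrArg (fun t ↦ k (0, t)) hθ0, by simp [hθ0], ?_, ?_⟩
  · have h1 : HasFDerivAt (fun p : V × ℝ ↦ p.2 - θ p.1) (prodForm ((2⁻¹ : ℝ) • α) 1) 0 := by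
      refine (hasFDerivAt_snd.sub (HasFDerivAt.comp (g := θ) (f := Prod.fst) (0 : V × ℝ)
        hθd hasFDerivAt_fst)).congr_fderiv ?_
      ext p <;> simp
    refine (h1.mul hroot.differentiableAt.hasFDerivAt).congr_fderiv ?_
    have : m ((0 : V), (0 : ℝ)) = 1 := hm0
    ext p <;> simp [hθ0, this]
  · have hpos : ∀ᶠ p in 𝓝 (0 : V × ℝ), 0 < m p :=
      hm.continuous.continuousAt.eventually (lt_mem_nhds (by rw [hm0]; exact one_pos))
    filter_upwards [hshift.eventually hfm, hshift.eventually hpos] with p h1 h2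
    simp only [f, sub_add_cancel] at h1
    rw [mul_pow, Real.sq_sqrt h2.le]
    exact (sub_eq_iff_eq_add'.1 h1)

end NormalForm

theorem fderiv_pi_apply {ι E : Type} [Fintype ι] [NormedAddCommGroup E] [NormedSpace ℝ E]
    {f : E → ι → ℝ}
    {x : E}
    (hf : DifferentiableAt ℝ f x) (v : E) (i : ι) :
    fderiv ℝ f x v i = fderiv ℝ (fun y ↦ f y i) x v := by
  rw [((hasFDerivAt_pi'.1 hf.hasFDerivAt) i).fderiv]
  rfl

section NormalForm

variable {ι : Type} [Fintype ι] [DecidableEq ι]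

/-- A map-germ `(x, t) ↦ (x, h (x, t))` such that `∂_t h` vanishes at the origin with derivative
`(x, t) ↦ x + 2 t e_ℓ` there is equivalent to `(x, s) ↦ (x, s x + s (s - x_ℓ) e_ℓ)`. -/
theorem SmoothNear.exists_normalForm (ℓ : ι) {h : (ι → ℝ) × ℝ → ι → ℝ} (hh : SmoothNear h 0)
    (h0 : h 0 = 0) (h1 : fderiv ℝ h 0 (0, 1) = 0)
    {D : (ι → ℝ) × ℝ →L[ℝ] ι → ℝ} (hD : HasFDerivAt (fun p ↦ fderiv ℝ h p (0, 1)) D 0)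
    (hDe : ∀ p, D p = p.1 + (2 * p.2) • Pi.single ℓ 1) :
    ∃ (Φ : (ι → ℝ) × (ι → ℝ) → (ι → ℝ) × (ι → ℝ)) (ψ : (ι → ℝ) × ℝ → (ι → ℝ) × ℝ),
      SmoothNear Φ 0 ∧ SmoothNear ψ 0 ∧ Φ 0 = 0 ∧ ψ 0 = 0 ∧
      Function.Injective (fderiv ℝ Φ 0) ∧ Function.Injective (fderiv ℝ ψ 0) ∧
      ∀ᶠ p in 𝓝 0, Φ (p.1, h p) =
        ((ψ p).1, fun i ↦ if i = ℓ then (ψ p).2 ^ 2 else (ψ p).2 * (ψ p).1 i) := by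
  let πℓ : (ι → ℝ) →L[ℝ] ℝ := ContinuousLinearMap.proj ℓ
  have hk : SmoothNear (fun p ↦ h p ℓ) 0 := hh.apply ℓ
  have hkd : ∀ᶠ p in 𝓝 0, fderiv ℝ h p (0, 1) ℓ = fderiv ℝ (fun p ↦ h p ℓ) p (0, 1) := by
    filter_upwards [hh] with p hp using fderiv_pi_apply (hp.differentiableAt (by simp)) _ _
  have hkD : HasFDerivAt (fun p ↦ fderiv ℝ (fun p ↦ h p ℓ) p (0, 1)) (prodForm πℓ 2) 0 := by
    refine (((hasFDerivAt_pi'.1 hD) ℓ).congr_of_eventuallyEq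
      (hkd.mono fun p hp ↦ hp.symm)).congr_fderiv ?_
    ext p <;> simp [hDe, πℓ]
  obtain ⟨c, S, hc, hS, hc0, hS0, hSd, hkS⟩ :=
    hk.exists_morse (by rw [← hkd.self_of_nhds, h1]; rfl) hkD
  have hc0' : c 0 = 0 := by rw [hc0, h0]; rfl
  obtain ⟨T, hT, hT0, hTd, -, hTS⟩ := hS.exists_fiberInverse hS0 one_ne_zero hSd
  have hPT : SmoothNear (fun p : (ι → ℝ) × ℝ ↦ (p.1, T p)) 0 := contDiff_fst.smoothNear.prodMk hT
  have hPT0 : ((0 : (ι → ℝ) × ℝ).1, T 0) = 0 := by rw [hT0]; rfl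
  have hH : SmoothNear (fun p ↦ h (p.1, T p)) 0 := by
    refine SmoothNear.comp (g := h) ?_ hPT
    rwa [hPT0]
  obtain ⟨A, B, hA, hB, hAB⟩ := hH.exists_even_odd
  have hA0 : A 0 = 0 := by
    have := hAB.self_of_nhds
    simp only [hPT0, h0] at this
    simpa [Prod.mk_zero_zero] using this.symm
  have hB1 : ∀ᶠ x in 𝓝 (0 : ι → ℝ), B (x, 0) =
      fderiv ℝ T (x, 0) (0, 1) • fderiv ℝ h (x, T (x, 0)) (0, 1) := by
    have h2 : Tendsto (fun x : ι → ℝ ↦ (x, (0 : ℝ))) (𝓝 0) (𝓝 0) :=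
      Continuous.tendsto' (by fun_prop) _ _ rfl
    have h3 : Tendsto (fun p : (ι → ℝ) × ℝ ↦ (p.1, T p)) (𝓝 0) (𝓝 0) := by
      have := hPT.continuousAt.tendsto
      rwa [hPT0] at this
    filter_upwards [eventually_eventually_fiber hAB, h2.eventually hT,
      h2.eventually (h3.eventually hh)] with x h4 h5 h6
    have h7 : HasDerivAt (fun s ↦ h (x, T (x, s)))
        (fderiv ℝ T (x, 0) (0, 1) • fderiv ℝ h (x, T (x, 0)) (0, 1)) 0 :=
      HasDerivAt.scomp (0 : ℝ) (g₁ := fun t ↦ h (x, t)) (h := fun s ↦ T (x, s))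
        (hasDerivAt_fiber (h6.differentiableAt (by simp)))
        (hasDerivAt_fiber (h5.differentiableAt (by simp)))
    have h8 : HasDerivAt (fun s ↦ A (x, s ^ 2)) ((0 : ℝ) • fderiv ℝ A (x, 0 ^ 2) (0, 1)) 0 := by
      have := HasDerivAt.scomp (0 : ℝ) (g₁ := fun t ↦ A (x, t)) (h := fun s : ℝ ↦ s ^ 2)
        (hasDerivAt_fiber (hA.differentiable (by simp) _)) (hasDerivAt_pow 2 (0 : ℝ))
      simpa [Function.comp_def] using this
    have h9 : HasDerivAt (fun s : ℝ ↦ s • B (x, s ^ 2)) (B (x, 0 ^ 2)) 0 :=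
      hasDerivAt_smul_of_continuousAt (w := fun s : ℝ ↦ B (x, s ^ 2))
        (hB.continuous.comp (by fun_prop : Continuous fun s : ℝ ↦ (x, s ^ 2))).continuousAt
    have h10 := ((h8.add h9).congr_of_eventuallyEq h4).unique h7
    simpa using h10
  have hB0 : B 0 = 0 := by
    have := hB1.self_of_nhds
    rw [show T ((0 : ι → ℝ), (0 : ℝ)) = 0 from hT0] at this
    rw [show ((0 : ι → ℝ), (0 : ℝ)) = 0 from rfl, h1, smul_zero] at this
    exact this
  have hBd : ∀ x, fderiv ℝ B 0 (x, 0) = x - x ℓ • Pi.single ℓ 1 := by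
    intro x
    have hι : HasFDerivAt (fun x : ι → ℝ ↦ (x, (0 : ℝ)))
      (ContinuousLinearMap.inl ℝ (ι → ℝ) ℝ) 0 := (ContinuousLinearMap.inl ℝ (ι → ℝ) ℝ).hasFDerivAt
    have h2 : HasFDerivAt (fun x : ι → ℝ ↦ B (x, 0)) _ 0 :=
      HasFDerivAt.comp (g := B) (f := fun x : ι → ℝ ↦ (x, (0 : ℝ))) 0
        (hB.differentiable (by simp) _).hasFDerivAt hι
    have h3 : HasFDerivAt (fun x : ι → ℝ ↦ (x, T (x, 0))) _ 0 :=
      (hasFDerivAt_id 0).prodMk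
        (HasFDerivAt.comp (g := T) (f := fun x : ι → ℝ ↦ (x, (0 : ℝ))) 0 hTd hι)
    have h3' : ((0 : ι → ℝ), T (0, 0)) = 0 := hPT0
    have h4 : HasFDerivAt (fun x : ι → ℝ ↦ fderiv ℝ h (x, T (x, 0)) (0, 1)) _ 0 :=
      HasFDerivAt.comp (g := fun p ↦ fderiv ℝ h p (0, 1)) (f := fun x : ι → ℝ ↦ (x, T (x, 0))) 0
        (by rw [h3']; exact hD) h3
    have h5 : DifferentiableAt ℝ (fun x : ι → ℝ ↦ fderiv ℝ T (x, 0) (0, 1)) 0 :=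
      DifferentiableAt.comp (g := fun p ↦ fderiv ℝ T p (0, 1)) (f := fun x : ι → ℝ ↦ (x, (0 : ℝ))) 0
        (hT.fderiv_apply (0, 1)).differentiableAt hι.differentiableAt
    have h6 := (h2.unique ((h5.hasFDerivAt.smul h4).congr_of_eventuallyEq hB1))
    have h7 := DFunLike.congr_fun h6 x
    have h8 : fderiv ℝ T (0, 0) (0, 1) = 1 := by
      rw [show ((0 : ι → ℝ), (0 : ℝ)) = 0 from rfl, hTd.fderiv]; simp
    simp only [h3', h1, h8] at h7
    simp [hDe, πℓ, Prod.mk_zero_zero] at h7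
    rw [h7]
    ext i
    simp
    ring
  let W : (ι → ℝ) × (ι → ℝ) → ℝ := fun p ↦ p.2 ℓ - c p.1
  have hW : SmoothNear W 0 := (contDiff_snd.smoothNear.apply ℓ).sub
    (SmoothNear.comp (f := Prod.fst) hc contDiff_fst.smoothNear)
  have hW0 : W 0 = 0 := by simp [W, hc0']
  have hWd : ∀ v, fderiv ℝ W 0 v = v.2 ℓ - fderiv ℝ c 0 v.1 := by
    intro v
    have h2 : HasFDerivAt (fun p : (ι → ℝ) × (ι → ℝ) ↦ p.2 ℓ) _ 0 :=
      ((hasFDerivAt_pi'.1 (hasFDerivAt_snd (𝕜 := ℝ) (p := (0 : (ι → ℝ) × (ι → ℝ)))))) ℓ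
    have h3 : HasFDerivAt W _ 0 := h2.sub
      (HasFDerivAt.comp (g := c) (f := Prod.fst) (0 : (ι → ℝ) × (ι → ℝ))
      hc.differentiableAt.hasFDerivAt hasFDerivAt_fst)
    rw [h3.fderiv]
    simp
  have hcomp : ∀ {E : Type} [NormedAddCommGroup E] [NormedSpace ℝ E] {K : (ι → ℝ) × ℝ → ι → ℝ}
      {a : E → ι → ℝ} {w : E → ℝ}, ContDiff ℝ ∞ K → DifferentiableAt ℝ a 0 →
      DifferentiableAt ℝ w 0 → a 0 = 0 → w 0 = 0 → HasFDerivAt (fun p ↦ K (a p, w p))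
        ((fderiv ℝ K 0).comp ((fderiv ℝ a 0).prod (fderiv ℝ w 0))) 0 := by
    intro E _ _ K a w hK ha hw ha0 hw0
    refine HasFDerivAt.comp (g := K) (f := fun p : E ↦ (a p, w p)) 0 ?_
      (ha.hasFDerivAt.prodMk hw.hasFDerivAt)
    rw [ha0, hw0]
    exact (hK.differentiable (by simp) _).hasFDerivAt
  have hcompS : ∀ {E : Type} [NormedAddCommGroup E] [NormedSpace ℝ E] {K : (ι → ℝ) × ℝ → ι → ℝ}
      {a : E → ι → ℝ} {w : E → ℝ}, ContDiff ℝ ∞ K → SmoothNear a 0 →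
      SmoothNear w 0 → SmoothNear (fun p ↦ K (a p, w p)) 0 := fun hK ha hw ↦
    SmoothNear.comp (g := _) hK.smoothNear (ha.prodMk hw)
  let Φ : (ι → ℝ) × (ι → ℝ) → (ι → ℝ) × (ι → ℝ) := fun p ↦
    (fun i ↦ if i = ℓ then p.1 ℓ else B (p.1, W p) i,
      fun i ↦ if i = ℓ then W p else p.2 i - A (p.1, W p) i)
  let ψ : (ι → ℝ) × ℝ → (ι → ℝ) × ℝ := fun p ↦
    (fun i ↦ if i = ℓ then p.1 ℓ else B (p.1, S p ^ 2) i, S p)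
  have hSsq : SmoothNear (fun p ↦ S p ^ 2) 0 := by simpa only [sq] using hS.mul hS
  have hΦ : SmoothNear Φ 0 := by
    refine SmoothNear.prodMk (.pi fun i ↦ ?_) (.pi fun i ↦ ?_) <;> by_cases hi : i = ℓ <;>
      simp only [hi, if_true, if_false]
    · exact contDiff_fst.smoothNear.apply ℓ
    · exact (hcompS hB contDiff_fst.smoothNear hW).apply i
    · exact hW
    · exact (contDiff_snd.smoothNear.apply i).sub
        ((hcompS hA contDiff_fst.smoothNear hW).apply i)
  have hψ : SmoothNear ψ 0 := by
    refine SmoothNear.prodMk (.pi fun i ↦ ?_) hS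
    by_cases hi : i = ℓ <;> simp only [hi, if_true, if_false]
    · exact contDiff_fst.smoothNear.apply ℓ
    · exact (hcompS hB contDiff_fst.smoothNear hSsq).apply i
  refine ⟨Φ, ψ, hΦ, hψ, ?_, ?_, ?_, ?_, ?_⟩
  · ext i <;> by_cases hi : i = ℓ <;> simp [Φ, hi, hW0, Prod.mk_zero_zero, hA0, hB0]
  · ext i
    · by_cases hi : i = ℓ <;> simp [ψ, hi, hS0, Prod.mk_zero_zero, hB0]
    · exact hS0
  · refine (injective_iff_map_eq_zero _).2 fun v hv ↦ ?_
    have hd := hΦ.differentiableAt.hasFDerivAt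
    have h2 := fun i ↦ hasFDerivAt_pi'.1 hd.fst i
    have h3 := fun i ↦ hasFDerivAt_pi'.1 hd.snd i
    have hBW := hcomp (a := fun p : (ι → ℝ) × (ι → ℝ) ↦ p.1) hB differentiableAt_fst
      hW.differentiableAt rfl hW0
    have hAW := hcomp (a := fun p : (ι → ℝ) × (ι → ℝ) ↦ p.1) hA differentiableAt_fst
      hW.differentiableAt rfl hW0
    have hvℓ : v.1 ℓ = 0 := by
      have h4 := hasFDerivAt_pi'.1 (hasFDerivAt_fst (𝕜 := ℝ) (p := (0 : (ι → ℝ) × (ι → ℝ)))) ℓ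
      have h5 := DFunLike.congr_fun
        ((h2 ℓ).unique (h4.congr_of_eventuallyEq (.of_forall fun p ↦ by simp [Φ]))) v
      simpa [hv] using h5.symm
    have hWv : fderiv ℝ W 0 v = 0 := by
      have h5 := DFunLike.congr_fun ((h3 ℓ).unique
        (hW.differentiableAt.hasFDerivAt.congr_of_eventuallyEq
          (.of_forall fun p ↦ by simp [Φ]))) v
      simpa [hv] using h5.symm
    have hv1 : v.1 = 0 := by
      ext i
      by_cases hi : i = ℓ
      · rw [hi, hvℓ]; rfl
      · have h5 := DFunLike.congr_fun ((h2 i).unique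
          ((hasFDerivAt_pi'.1 hBW i).congr_of_eventuallyEq
          (.of_forall fun p ↦ by simp [Φ, hi]))) v
        simp [hv, hWv, hBd, hvℓ, fderiv_fst] at h5
        exact h5.symm
    have hv2 : v.2 = 0 := by
      ext i
      by_cases hi : i = ℓ
      · have := hWd v
        rw [hWv, hv1, map_zero, sub_zero] at this
        rw [hi, ← this]; rfl
      · have h4 := hasFDerivAt_pi'.1 (hasFDerivAt_snd (𝕜 := ℝ) (p := (0 : (ι → ℝ) × (ι → ℝ)))) i
        have h5 := DFunLike.congr_fun ((h3 i).unique
          ((h4.sub (hasFDerivAt_pi'.1 hAW i)).congr_of_eventuallyEq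
          (.of_forall fun p ↦ by simp [Φ, hi]))) v
        simp [hv, hWv, hv1, fderiv_fst, Prod.mk_zero_zero] at h5
        exact h5.symm
    exact Prod.ext hv1 hv2
  · refine (injective_iff_map_eq_zero _).2 fun v hv ↦ ?_
    have hd := hψ.differentiableAt.hasFDerivAt
    have h2 := fun i ↦ hasFDerivAt_pi'.1 hd.fst i
    have h3 := hd.snd.unique hSd
    have hsq0 : fderiv ℝ (fun p ↦ S p ^ 2) 0 = 0 := by
      have := hSd.pow 2
      rw [HasFDerivAt.fderiv this, hS0]; simp
    have hBS := hcomp (a := fun p : (ι → ℝ) × ℝ ↦ p.1) hB differentiableAt_fst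
      hSsq.differentiableAt rfl (by simp [hS0])
    have hvℓ : v.1 ℓ = 0 := by
      have h4 := hasFDerivAt_pi'.1 (hasFDerivAt_fst (𝕜 := ℝ) (p := (0 : (ι → ℝ) × ℝ))) ℓ
      have h5 := DFunLike.congr_fun
        ((h2 ℓ).unique (h4.congr_of_eventuallyEq (.of_forall fun p ↦ by simp [ψ]))) v
      simpa [hv] using h5.symm
    have hv2 : v.2 = 0 := by
      have := DFunLike.congr_fun h3 v
      simpa [hv, πℓ, hvℓ] using this.symm
    refine Prod.ext (funext fun i ↦ ?_) hv2
    by_cases hi : i = ℓ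
    · rw [hi, hvℓ]; rfl
    · have h5 := DFunLike.congr_fun ((h2 i).unique ((hasFDerivAt_pi'.1 hBS i).congr_of_eventuallyEq
        (.of_forall fun p ↦ by simp [ψ, hi]))) v
      simp [hv, hsq0, hBd, hvℓ, fderiv_fst] at h5
      exact h5.symm
  · have h2 : Tendsto (fun p : (ι → ℝ) × ℝ ↦ (p.1, S p)) (𝓝 0) (𝓝 0) := by
      have := (continuousAt_fst.prodMk hS.continuousAt).tendsto
      simpa [hS0, Prod.mk_zero_zero] using this
    filter_upwards [h2.eventually hAB, hTS, hkS] with p h3 h4 h5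
    simp only [h4] at h3
    have h6 : W (p.1, h p) = S p ^ 2 := by simp only [W, h5]; ring
    simp only [Φ, ψ, h6]
    refine Prod.ext rfl (funext fun i ↦ ?_)
    by_cases hi : i = ℓ
    · simp [hi]
    · have := congrFun h3 i
      simp [hi, this]

end NormalForm

section Frame

variable {Y : Type} [NormedAddCommGroup Y] [NormedSpace ℝ Y] {n : ℕ}

/-- The family of planes `(u, t) ↦ g t + ∑ uᵢ dᵢ(t)`. -/
def planeFamily (g : ℝ → Y) (d : Fin n → ℝ → Y) (p : (Fin n → ℝ) × ℝ) : Y :=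
  g p.2 + ∑ i, p.1 i • d i p.2

theorem planeFamily_zero {g : ℝ → Y} (d : Fin n → ℝ → Y) (h0 : g 0 = 0) :
    planeFamily g d 0 = 0 := by
  simp [planeFamily, h0]

theorem SmoothNear.smul {E F : Type} [NormedAddCommGroup E] [NormedSpace ℝ E]
    [NormedAddCommGroup F] [NormedSpace ℝ F] {x : E} {c : E → ℝ} {f : E → F}
    (hc : SmoothNear c x) (hf : SmoothNear f x) : SmoothNear (fun y ↦ c y • f y) x := by
  filter_upwards [hc, hf] with y h1 h2 using h1.smul h2

theorem SmoothNear.sum {E F ι : Type} [NormedAddCommGroup E] [NormedSpace ℝ E]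
    [NormedAddCommGroup F] [NormedSpace ℝ F] [Fintype ι] {x : E} {f : ι → E → F}
    (hf : ∀ i, SmoothNear (f i) x) : SmoothNear (fun y ↦ ∑ i, f i y) x := by
  filter_upwards [eventually_all.2 hf] with y h1 using ContDiffAt.sum fun i _ ↦ h1 i

theorem SmoothNear.deriv {F : Type} [NormedAddCommGroup F] [NormedSpace ℝ F] {f : ℝ → F} {t : ℝ}
    (hf : SmoothNear f t) : SmoothNear (deriv f) t :=
  (hf.fderiv_apply 1).congr (.of_forall fun _ ↦ fderiv_apply_one_eq_deriv.symm)

theorem smoothNear_planeFamily {g : ℝ → Y} {d : Fin n → ℝ → Y} (hg : SmoothNear g 0)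
    (hd : ∀ i, SmoothNear (d i) 0) : SmoothNear (planeFamily g d) 0 :=
  (SmoothNear.comp (g := g) (f := Prod.snd) hg contDiff_snd.smoothNear).add
    (.sum fun i ↦ (contDiff_fst.smoothNear.apply i).smul
      (SmoothNear.comp (g := d i) (f := Prod.snd) (hd i) contDiff_snd.smoothNear))

theorem fderiv_planeFamily {g : ℝ → Y} {d : Fin n → ℝ → Y} {a : Fin n → ℝ → ℝ}
    {p : (Fin n → ℝ) × ℝ} (hg : HasDerivAt g (∑ i, a i p.2 • d i p.2) p.2)
    (hd : ∀ i, DifferentiableAt ℝ (d i) p.2) (v : (Fin n → ℝ) × ℝ) :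
    fderiv ℝ (planeFamily g d) p v = (∑ i, (a i p.2 * v.2 + v.1 i) • d i p.2) +
      ∑ i, (p.1 i * v.2) • deriv (d i) p.2 := by
  have h1 : HasFDerivAt (fun p : (Fin n → ℝ) × ℝ ↦ g p.2) _ p :=
    hg.hasFDerivAt.comp p hasFDerivAt_snd
  have h2 : ∀ i, HasFDerivAt (fun p : (Fin n → ℝ) × ℝ ↦ p.1 i • d i p.2) _ p := fun i ↦
    (hasFDerivAt_pi'.1 (hasFDerivAt_fst (𝕜 := ℝ) (p := p)) i).smul
      ((hd i).hasDerivAt.hasFDerivAt.comp p hasFDerivAt_snd)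
  have h3 : HasFDerivAt (planeFamily g d) _ p := h1.add (HasFDerivAt.fun_sum fun i _ ↦ h2 i)
  rw [h3.fderiv]
  simp [add_smul, Finset.sum_add_distrib, Finset.smul_sum, smul_smul, mul_comm]
  abel

theorem eventually_fderiv_planeFamily {g : ℝ → Y} {d : Fin n → ℝ → Y} {a : Fin n → ℝ → ℝ}
    (hg : SmoothNear g 0) (hd : ∀ i, SmoothNear (d i) 0)
    (hgd : ∀ᶠ t in 𝓝 0, deriv g t = ∑ i, a i t • d i t) :
    ∀ᶠ p in 𝓝 (0 : (Fin n → ℝ) × ℝ), ∀ v, fderiv ℝ (planeFamily g d) p v =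
      (∑ i, (a i p.2 * v.2 + v.1 i) • d i p.2) + ∑ i, (p.1 i * v.2) • deriv (d i) p.2 := by
  have h1 : Tendsto (Prod.snd : (Fin n → ℝ) × ℝ → ℝ) (𝓝 0) (𝓝 0) :=
    Continuous.tendsto' continuous_snd _ _ rfl
  filter_upwards [h1.eventually hgd, h1.eventually hg, h1.eventually (eventually_all.2 hd)]
    with p h2 h3 h4 v
  refine fderiv_planeFamily ?_ (fun i ↦ (h4 i).differentiableAt (by simp)) v
  rw [← h2]
  exact (h3.differentiableAt (by simp)).hasDerivAt

end Frame

theorem HasFDerivAt.smul_of_apply_eq_zero {E F : Type} [NormedAddCommGroup E] [NormedSpace ℝ E]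
    [NormedAddCommGroup F] [NormedSpace ℝ F] {x : E} {c : E → ℝ} {c' : E →L[ℝ] ℝ} {f : E → F}
    (hc : HasFDerivAt c c' x) (hf : DifferentiableAt ℝ f x) (h0 : c x = 0) :
    HasFDerivAt (fun y ↦ c y • f y) (c'.smulRight (f x)) x := by
  refine (hc.smul hf.hasFDerivAt).congr_fderiv ?_
  rw [h0, zero_smul, zero_add]

theorem exists_continuousLinearEquiv_of_injective {E : Type} [NormedAddCommGroup E]
    [NormedSpace ℝ E] [FiniteDimensional ℝ E] {A : E →L[ℝ] E} (hA : Function.Injective A) :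
    ∃ e : E ≃L[ℝ] E, (e : E →L[ℝ] E) = A :=
  ⟨(LinearEquiv.ofInjectiveEndo A.toLinearMap hA).toContinuousLinearEquiv, by ext; rfl⟩

section Frame

variable {Y : Type} [NormedAddCommGroup Y] [NormedSpace ℝ Y] {n : ℕ}

theorem exists_planeFamily_normalForm (ℓ : Fin n) {g : ℝ → Y} {d : Fin n → ℝ → Y}
    {a : Fin n → ℝ → ℝ} (L : Y ≃L[ℝ] (Fin n → ℝ) × (Fin n → ℝ))
    (hLd : ∀ i, L (d i 0) = (Pi.single i 1, 0)) (hLd' : ∀ i, L (deriv (d i) 0) = (0, Pi.single i 1))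
    (hg : SmoothNear g 0) (hd : ∀ i, SmoothNear (d i) 0) (ha : ∀ i, SmoothNear (a i) 0)
    (hg0 : g 0 = 0) (hgd : ∀ᶠ t in 𝓝 0, deriv g t = ∑ i, a i t • d i t)
    (ha0 : (fun i ↦ a i 0) ≠ 0) :
    ∃ (Φ : Y → (Fin n → ℝ) × (Fin n → ℝ)) (κ : (Fin n → ℝ) × ℝ → (Fin n → ℝ) × ℝ),
      SmoothNear Φ 0 ∧ SmoothNear κ 0 ∧ Φ 0 = 0 ∧ κ 0 = 0 ∧
      Function.Injective (fderiv ℝ Φ 0) ∧ Function.Injective (fderiv ℝ κ 0) ∧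
      ∀ᶠ z in 𝓝 0, Φ (planeFamily g d (κ z)) =
        (z.1, fun i ↦ if i = ℓ then z.2 ^ 2 else z.2 * z.1 i) := by
  set a0 : Fin n → ℝ := fun i ↦ a i 0 with ha0'
  have hF : SmoothNear (planeFamily g d) 0 := smoothNear_planeFamily hg hd
  have hF0 : planeFamily g d 0 = 0 := planeFamily_zero d hg0
  have hFd := eventually_fderiv_planeFamily hg hd hgd
  obtain ⟨M, hM⟩ : ∃ M : (Fin n → ℝ) ≃L[ℝ] (Fin n → ℝ), M a0 = (-2 : ℝ) • Pi.single ℓ 1 := by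
    refine SeparatingDual.exists_continuousLinearEquiv_apply_eq ha0 ?_
    intro h
    have := congrFun h ℓ
    simp at this
  let e : ((Fin n → ℝ) × ℝ) ≃L[ℝ] ((Fin n → ℝ) × ℝ) := ContinuousLinearEquiv.equivOfInverse
    ((M.toContinuousLinearMap.comp (ContinuousLinearMap.fst ℝ _ ℝ +
      (ContinuousLinearMap.snd ℝ _ ℝ).smulRight a0)).prod (ContinuousLinearMap.snd ℝ _ ℝ))
    ((M.symm.toContinuousLinearMap.comp (ContinuousLinearMap.fst ℝ _ ℝ) -
      (ContinuousLinearMap.snd ℝ _ ℝ).smulRight a0).prod (ContinuousLinearMap.snd ℝ _ ℝ))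
    (fun p ↦ by ext <;> simp) (fun p ↦ by ext <;> simp)
  have he' : ∀ p, e.symm p = (M.symm p.1 - p.2 • a0, p.2) := fun p ↦ rfl
  let MLx : Y →L[ℝ] Fin n → ℝ := M.toContinuousLinearMap.comp
    ((ContinuousLinearMap.fst ℝ _ _).comp L.toContinuousLinearMap)
  let MLy : Y →L[ℝ] Fin n → ℝ := M.toContinuousLinearMap.comp
    ((ContinuousLinearMap.snd ℝ _ _).comp L.toContinuousLinearMap)
  let G : (Fin n → ℝ) × ℝ → (Fin n → ℝ) × ℝ := fun p ↦ (MLx (planeFamily g d p), p.2)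
  have hG0 : G 0 = 0 := by simp [G, hF0]
  have hsum : ∀ x : Fin n → ℝ, ∑ i, x i • (Pi.single i 1 : Fin n → ℝ) = x := fun x ↦ by
    rw [← pi_eq_sum_univ' x]
  have hG : SmoothNear G 0 :=
    (SmoothNear.comp (g := MLx) MLx.contDiff.smoothNear hF).prodMk contDiff_snd.smoothNear
  have hGd : HasFDerivAt G (e : (Fin n → ℝ) × ℝ →L[ℝ] (Fin n → ℝ) × ℝ) 0 := by
    refine ((MLx.hasFDerivAt.comp 0 hF.differentiableAt.hasFDerivAt).prodMk
      hasFDerivAt_snd).congr_fderiv ?_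
    refine ContinuousLinearMap.ext fun v ↦ ?_
    change (MLx (fderiv ℝ (planeFamily g d) 0 v), v.2) = (M (v.1 + v.2 • a0), v.2)
    have h1 : ∀ i, MLx (d i 0) = M (Pi.single i 1) := fun i ↦ by simp [MLx, hLd]
    have h2 : (fun i ↦ a i 0 * v.2 + v.1 i) = v.1 + v.2 • a0 := by
      ext i
      simp [a0, mul_comm, add_comm]
    rw [hFd.self_of_nhds v, ← h2]
    simp only [Prod.fst_zero, Prod.snd_zero, Pi.zero_apply, zero_mul, zero_smul,
      Finset.sum_const_zero, add_zero, map_sum, map_smul, h1]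
    simp only [← map_smul, ← map_sum]
    rw [hsum fun i ↦ a i 0 * v.2 + v.1 i]
  obtain ⟨K, hK, hK0, hKd, hKG, hGK⟩ := hG.exists_localInverse hGd
  rw [hG0] at hK hK0 hKd hGK
  let k : (Fin n → ℝ) × ℝ → (Fin n → ℝ) × ℝ := fun p ↦ fderiv ℝ K p (0, 1)
  have hk : SmoothNear k 0 := hK.fderiv_apply _
  have hk0 : k 0 = (-a0, 1) := by simp [k, hKd.fderiv, he']
  let h : (Fin n → ℝ) × ℝ → Fin n → ℝ := fun p ↦ MLy (planeFamily g d (K p))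
  have hFK : SmoothNear (fun p ↦ planeFamily g d (K p)) 0 :=
    SmoothNear.comp (by rwa [hK0]) hK
  have hh : SmoothNear h 0 := SmoothNear.comp (g := MLy) MLy.contDiff.smoothNear hFK
  have hh0 : h 0 = 0 := by simp [h, hK0, hF0]
  have hKt : Tendsto K (𝓝 0) (𝓝 0) := by
    have := hK.continuousAt.tendsto
    rwa [hK0] at this
  have hhd : ∀ᶠ p in 𝓝 0, fderiv ℝ h p (0, 1) =
      (∑ i, (a i (K p).2 * (k p).2 + (k p).1 i) • MLy (d i (K p).2)) +
      ∑ i, ((K p).1 i * (k p).2) • MLy (deriv (d i) (K p).2) := by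
    filter_upwards [hK, hKt.eventually hF, hKt.eventually hFd] with p h1 h2 h3
    have h4 : HasFDerivAt h _ p := MLy.hasFDerivAt.comp p ((h2.differentiableAt
      (by simp)).hasFDerivAt.comp p (h1.differentiableAt (by simp)).hasFDerivAt)
    rw [h4.fderiv]
    simp only [ContinuousLinearMap.comp_apply, h3, map_add, map_sum, map_smul]
    rfl
  have hq : SmoothNear (fun p ↦ (K p).2) 0 := hK.snd
  have hq0 : (K 0).2 = 0 := by rw [hK0]; rfl
  have hMLyd : ∀ i, MLy (d i (K 0).2) = 0 := fun i ↦ by simp [MLy, hq0, hLd]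
  have hMLyd' : ∀ i, MLy (deriv (d i) (K 0).2) = M (Pi.single i 1) := fun i ↦ by
    simp [MLy, hq0, hLd']
  let C : Fin n → (Fin n → ℝ) × ℝ → ℝ := fun i p ↦ a i (K p).2 * (k p).2 + (k p).1 i
  let Q : Fin n → (Fin n → ℝ) × ℝ → ℝ := fun i p ↦ (K p).1 i * (k p).2
  have hC : ∀ i, SmoothNear (C i) 0 := fun i ↦
    ((SmoothNear.comp (g := a i) (by rw [hq0]; exact ha i) hq).mul hk.snd).add (hk.fst.apply i)
  have hQ : ∀ i, SmoothNear (Q i) 0 := fun i ↦ (hK.fst.apply i).mul hk.snd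
  have hC0 : ∀ i, C i 0 = 0 := fun i ↦ by simp [C, hq0, hk0, a0]
  have hQ0 : ∀ i, Q i 0 = 0 := fun i ↦ by simp [Q, hK0]
  have hQd : ∀ i v, fderiv ℝ (Q i) 0 v = (M.symm v.1 - v.2 • a0) i := by
    intro i v
    have h1 := hasFDerivAt_pi'.1 hKd.fst i
    have h2 : HasFDerivAt (Q i) _ 0 := h1.smul_of_apply_eq_zero hk.snd.differentiableAt
      (by simp [hK0])
    rw [h2.fderiv]
    simp [hk0, he']
  have hfr : ∀ {w : ℝ → Y}, SmoothNear w 0 →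
      DifferentiableAt ℝ (fun p ↦ MLy (w (K p).2)) 0 := fun {w} hw ↦
    (SmoothNear.comp (g := MLy) MLy.contDiff.smoothNear
      (SmoothNear.comp (g := w) (by rwa [hq0]) hq)).differentiableAt
  have hD := ((HasFDerivAt.fun_sum (u := Finset.univ) fun i _ ↦
      (hC i).differentiableAt.hasFDerivAt.smul_of_apply_eq_zero (hfr (hd i)) (hC0 i)).add
    (HasFDerivAt.fun_sum (u := Finset.univ) fun i _ ↦
      (hQ i).differentiableAt.hasFDerivAt.smul_of_apply_eq_zero
        (hfr (hd i).deriv) (hQ0 i))).congr_of_eventuallyEq hhd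
  have hh1 : fderiv ℝ h 0 (0, 1) = 0 := by
    rw [hhd.self_of_nhds]
    have h1 : ∀ i, a i (K 0).2 * (k 0).2 + (k 0).1 i = 0 := hC0
    simp only [h1, zero_smul, Finset.sum_const_zero, zero_add]
    simp [hK0]
  obtain ⟨Φ, ψ, hΦ, hψ, hΦ0, hψ0, hΦi, hψi, hΦψ⟩ := hh.exists_normalForm ℓ hh0 hh1 hD (by
    intro p
    simp only [_root_.add_apply, _root_.sum_apply,
      ContinuousLinearMap.smulRight_apply, hMLyd, hMLyd', smul_zero, Finset.sum_const_zero,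
      zero_add, hQd, ← map_smul, ← map_sum, hsum]
    simp only [map_sub, map_smul, ContinuousLinearEquiv.apply_symm_apply, hM]
    module)
  let ML : Y →L[ℝ] (Fin n → ℝ) × (Fin n → ℝ) := MLx.prod MLy
  have hML : Function.Injective ML := by
    intro y z hyz
    have h1 := M.injective (Prod.ext_iff.1 hyz).1
    have h2 := M.injective (Prod.ext_iff.1 hyz).2
    exact L.injective (Prod.ext h1 h2)
  have hψG : SmoothNear (fun p ↦ ψ (G p)) 0 := SmoothNear.comp (by rwa [hG0]) hG
  obtain ⟨e₁, he₁⟩ := exists_continuousLinearEquiv_of_injective hψi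
  have hψGd : HasFDerivAt (fun p ↦ ψ (G p))
      ((e.trans e₁ : _ ≃L[ℝ] _) : (Fin n → ℝ) × ℝ →L[ℝ] (Fin n → ℝ) × ℝ) 0 := by
    have h1 : HasFDerivAt ψ (e₁ : (Fin n → ℝ) × ℝ →L[ℝ] (Fin n → ℝ) × ℝ) (G 0) := by
      rw [he₁, hG0]; exact hψ.differentiableAt.hasFDerivAt
    exact h1.comp 0 hGd
  obtain ⟨κ, hκ, hκ0, hκd, -, hκr⟩ := hψG.exists_localInverse hψGd
  simp only [hG0, hψ0] at hκ hκ0 hκd hκr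
  have hκt : Tendsto κ (𝓝 0) (𝓝 0) := by
    have := hκ.continuousAt.tendsto
    rwa [hκ0] at this
  have hGt : Tendsto G (𝓝 0) (𝓝 0) := by
    have := hG.continuousAt.tendsto
    rwa [hG0] at this
  refine ⟨fun y ↦ Φ (ML y), κ, SmoothNear.comp (by rwa [map_zero]) ML.contDiff.smoothNear, hκ,
    by simp only [map_zero, hΦ0], hκ0, ?_, ?_, ?_⟩
  · have h1 : HasFDerivAt (fun y ↦ Φ (ML y)) ((fderiv ℝ Φ 0).comp ML) 0 := by
      refine HasFDerivAt.comp 0 ?_ ML.hasFDerivAt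
      rw [map_zero]
      exact hΦ.differentiableAt.hasFDerivAt
    rw [h1.fderiv]
    exact hΦi.comp hML
  · rw [hκd.fderiv]
    exact (e.trans e₁).symm.injective
  · filter_upwards [hκr, hκt.eventually hKG, hκt.eventually (hGt.eventually hΦψ)] with z h1 h2 h3
    rw [h1] at h3
    rw [← h3]
    simp only [h, h2]
    rfl

end Frame

theorem HasDerivAt.smul_of_apply_eq_zero {F : Type} [NormedAddCommGroup F] [NormedSpace ℝ F]
    {t : ℝ} {c : ℝ → ℝ} {c' : ℝ} {f : ℝ → F} (hc : HasDerivAt c c' t)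
    (hf : DifferentiableAt ℝ f t) (h0 : c t = 0) :
    HasDerivAt (fun s ↦ c s • f s) (c' • f t) t := by
  refine (hc.smul hf.hasDerivAt).congr_deriv ?_
  rw [h0, zero_smul, zero_add]

section Frame

variable {Y : Type} [NormedAddCommGroup Y] [NormedSpace ℝ Y] {n : ℕ}

theorem ne_zero_of_planeFamily_comp {E Z : Type} [NormedAddCommGroup E] [NormedSpace ℝ E]
    [NormedAddCommGroup Z] [NormedSpace ℝ Z] {g : ℝ → Y} {d : Fin n → ℝ → Y}
    {a : Fin n → ℝ → ℝ} (hg : SmoothNear g 0) (hd : ∀ i, SmoothNear (d i) 0)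
    (ha : ∀ i, SmoothNear (a i) 0) (hg0 : g 0 = 0)
    (hgd : ∀ᶠ t in 𝓝 0, deriv g t = ∑ i, a i t • d i t)
    (hli : LinearIndependent ℝ fun i ↦ d i 0)
    {κ : E → (Fin n → ℝ) × ℝ} {Φ : Y → Z} (hκ : ContDiffAt ℝ 2 κ 0) (hΦ : ContDiffAt ℝ 2 Φ 0)
    (hκ0 : κ 0 = 0) (hκs : Function.Surjective (fderiv ℝ κ 0))
    (hΦi : Function.Injective (fderiv ℝ Φ 0)) {w : E} {η : Z →L[ℝ] ℝ} {e : Z}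
    (hη : η e ≠ 0)
    (hcrit : ∀ v, HasDerivAt (fun s : ℝ ↦ η (Φ (planeFamily g d (κ (s • v))))) 0 0)
    (hw : ∀ᶠ s : ℝ in 𝓝 0, Φ (planeFamily g d (κ (s • w))) = s ^ 2 • e) :
    (fun i ↦ a i 0) ≠ 0 := by
  intro ha0
  have ha0' : ∀ i, a i 0 = 0 := congrFun ha0
  have hF : SmoothNear (planeFamily g d) 0 := smoothNear_planeFamily hg hd
  have hF0 : planeFamily g d 0 = 0 := planeFamily_zero d hg0
  have hFd := eventually_fderiv_planeFamily hg hd hgd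
  have hline : ∀ v : E, HasDerivAt (fun s : ℝ ↦ s • v) v 0 := fun v ↦ by
    simpa using (hasDerivAt_id (0 : ℝ)).smul_const v
  have hc1 : ∀ v : E, HasDerivAt (fun s : ℝ ↦ κ (s • v)) (fderiv ℝ κ 0 v) 0 := fun v ↦ by
    have h1 : HasFDerivAt κ (fderiv ℝ κ 0) ((0 : ℝ) • v) := by
      rw [zero_smul]; exact (hκ.differentiableAt (by simp)).hasFDerivAt
    exact h1.comp_hasDerivAt 0 (hline v)
  have hy1 : ∀ v : E, HasDerivAt (fun s : ℝ ↦ planeFamily g d (κ (s • v)))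
      (fderiv ℝ (planeFamily g d) 0 (fderiv ℝ κ 0 v)) 0 := fun v ↦ by
    have h1 : HasFDerivAt (planeFamily g d) (fderiv ℝ (planeFamily g d) 0) (κ ((0 : ℝ) • v)) := by
      rw [zero_smul, hκ0]; exact hF.differentiableAt.hasFDerivAt
    exact h1.comp_hasDerivAt 0 (hc1 v)
  have hΦy : ∀ v : E, HasDerivAt (fun s : ℝ ↦ Φ (planeFamily g d (κ (s • v))))
      (fderiv ℝ Φ 0 (fderiv ℝ (planeFamily g d) 0 (fderiv ℝ κ 0 v))) 0 := fun v ↦ by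
    have h1 : HasFDerivAt Φ (fderiv ℝ Φ 0) (planeFamily g d (κ ((0 : ℝ) • v))) := by
      rw [zero_smul, hκ0, hF0]; exact (hΦ.differentiableAt (by simp)).hasFDerivAt
    exact h1.comp_hasDerivAt 0 (hy1 v)
  have hF1 : ∀ v, fderiv ℝ (planeFamily g d) 0 v = ∑ i, v.1 i • d i 0 := fun v ↦ by
    rw [hFd.self_of_nhds]
    simp [ha0']
  have hηd : ∀ i, η (fderiv ℝ Φ 0 (d i 0)) = 0 := by
    intro i
    obtain ⟨v, hv⟩ := hκs (Pi.single i 1, 0)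
    have h1 := (η.hasFDerivAt.comp_hasDerivAt 0 (hΦy v)).unique (hcrit v)
    rw [hv, hF1] at h1
    simpa [Pi.single_apply] using h1
  let c : ℝ → (Fin n → ℝ) × ℝ := fun s ↦ κ (s • w)
  have hc : ContDiffAt ℝ 2 c 0 := by
    refine ContDiffAt.comp (g := κ) 0 (by rwa [zero_smul]) ?_
    exact contDiffAt_id.smul contDiffAt_const
  have hc0 : c 0 = 0 := by simp [c, hκ0]
  have hcd : DifferentiableAt ℝ (deriv c) 0 :=
    ((hc.fderiv_right (m := 1) (by norm_num)).differentiableAt (by simp)).clm_apply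
      (differentiableAt_const _)
  have hcn : ∀ᶠ s in 𝓝 0, HasDerivAt c (deriv c s) s := by
    filter_upwards [hc.eventually (by simp)] with s hs
    exact (hs.differentiableAt (by simp)).hasDerivAt
  have hct : Tendsto c (𝓝 0) (𝓝 0) := by
    have := hc.continuousAt.tendsto
    rwa [hc0] at this
  let p : Fin n → ℝ → ℝ := fun i s ↦ a i (c s).2 * (deriv c s).2 + (deriv c s).1 i
  let q : Fin n → ℝ → ℝ := fun i s ↦ (c s).1 i * (deriv c s).2
  let z : ℝ → Y := fun s ↦ ∑ i, p i s • d i (c s).2 + ∑ i, q i s • deriv (d i) (c s).2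
  have hyn : ∀ᶠ s in 𝓝 0, HasDerivAt (fun s ↦ planeFamily g d (c s)) (z s) s := by
    filter_upwards [hcn, hct.eventually hFd, hct.eventually hF] with s h1 h2 h3
    have h4 := (h3.differentiableAt (by simp)).hasFDerivAt.comp_hasDerivAt s h1
    rwa [h2] at h4
  have hyt : Tendsto (fun s ↦ planeFamily g d (c s)) (𝓝 0) (𝓝 0) := by
    have := hF.continuousAt.tendsto
    rw [hF0] at this
    exact this.comp hct
  have hz0 : z 0 = 0 := by
    apply hΦi
    have h1 : HasDerivAt (fun s ↦ Φ (planeFamily g d (c s))) (fderiv ℝ Φ 0 (z 0)) 0 := by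
      have h2 : HasFDerivAt Φ (fderiv ℝ Φ 0) (planeFamily g d (c 0)) := by
        rw [hc0, hF0]; exact (hΦ.differentiableAt (by simp)).hasFDerivAt
      exact h2.comp_hasDerivAt 0 hyn.self_of_nhds
    have h2 : HasDerivAt (fun s : ℝ ↦ s ^ 2 • e) 0 0 := by
      simpa using (hasDerivAt_pow 2 (0 : ℝ)).smul_const e
    rw [map_zero]
    exact h1.unique (h2.congr_of_eventuallyEq hw)
  have hq0 : ∀ i, q i 0 = 0 := fun i ↦ by simp [q, hc0]
  have hp0 : ∀ i, p i 0 = 0 := by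
    refine Fintype.linearIndependent_iff.1 hli (fun i ↦ p i 0) ?_
    simpa [z, hq0, hc0] using hz0
  have hu0 : ∀ i, (deriv c 0).1 i = 0 := fun i ↦ by simpa [p, hc0, ha0'] using hp0 i
  have hcc : DifferentiableAt ℝ c 0 := hcn.self_of_nhds.differentiableAt
  have hcomp : ∀ {F : Type} [NormedAddCommGroup F] [NormedSpace ℝ F] {f : ℝ → F},
      SmoothNear f 0 → DifferentiableAt ℝ (fun s ↦ f (c s).2) 0 := fun {F} _ _ {f} hf ↦
    DifferentiableAt.comp (g := f) 0 (by rw [hc0]; exact hf.differentiableAt) hcc.snd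
  have hpd : ∀ i, DifferentiableAt ℝ (p i) 0 := fun i ↦
    ((hcomp (ha i)).mul hcd.snd).add (differentiableAt_pi.1 hcd.fst i)
  have hqd : ∀ i, HasDerivAt (q i) 0 0 := fun i ↦ by
    have h1 : HasDerivAt (fun s ↦ (c s).1 i) ((deriv c 0).1 i) 0 :=
      hasDerivAt_pi.1 hcn.self_of_nhds.fst i
    refine (h1.mul hcd.snd.hasDerivAt).congr_deriv ?_
    simp [hu0, hc0]
  have hzd : HasDerivAt z (∑ i, deriv (p i) 0 • d i 0) 0 := by
    have h1 := (HasDerivAt.fun_sum (u := Finset.univ) fun i _ ↦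
      (hpd i).hasDerivAt.smul_of_apply_eq_zero (hcomp (hd i)) (hp0 i)).add
      (HasDerivAt.fun_sum (u := Finset.univ) fun i _ ↦
        (hqd i).smul_of_apply_eq_zero (hcomp (hd i).deriv) (hq0 i))
    refine h1.congr_deriv ?_
    simp [hc0]
  have hAd : DifferentiableAt ℝ (fun s ↦ fderiv ℝ Φ (planeFamily g d (c s))) 0 := by
    refine DifferentiableAt.comp (g := fderiv ℝ Φ) 0 ?_
      hyn.self_of_nhds.differentiableAt
    rw [hc0, hF0]
    exact (hΦ.fderiv_right (m := 1) (by norm_num)).differentiableAt (by simp)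
  have h1 := η.hasFDerivAt.comp_hasDerivAt 0 (hAd.hasDerivAt.clm_apply hzd)
  have h2 : ∀ᶠ s in 𝓝 0, η (fderiv ℝ Φ (planeFamily g d (c s)) (z s)) = 2 * s * η e := by
    filter_upwards [hyn, hyt.eventually (hΦ.eventually (by simp)), hw.eventually_nhds]
      with s h3 h4 h5
    have h6 : HasDerivAt (fun s ↦ Φ (planeFamily g d (c s))) _ s :=
      (h4.differentiableAt (by simp)).hasFDerivAt.comp_hasDerivAt s h3
    have h7 : HasDerivAt (fun s : ℝ ↦ s ^ 2 • e) ((2 * s) • e) s := by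
      simpa using (hasDerivAt_pow 2 s).smul_const e
    rw [h6.unique (h7.congr_of_eventuallyEq h5), map_smul, smul_eq_mul]
  have h3 : HasDerivAt (fun s : ℝ ↦ 2 * s * η e) (2 * η e) 0 := by
    simpa using ((hasDerivAt_id (0 : ℝ)).const_mul 2).mul_const (η e)
  have h4 := h1.unique (h3.congr_of_eventuallyEq h2)
  rw [hz0, hc0, hF0] at h4
  simp [hηd, hη] at h4

end Frame

/-- `ℝ^{n+1} ≃ ℝⁿ × ℝ`, splitting off the first coordinate. -/
def tailHeadEquiv (n : ℕ) : (Fin (n + 1) → ℝ) ≃L[ℝ] (Fin n → ℝ) × ℝ :=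
  LinearEquiv.toContinuousLinearEquiv
    { toFun := fun x ↦ (fun i ↦ x i.succ, x 0)
      invFun := fun p ↦ Fin.cons p.2 p.1
      map_add' := fun _ _ ↦ rfl
      map_smul' := fun _ _ ↦ rfl
      left_inv := fun x ↦ Fin.cons_self_tail x
      right_inv := fun p ↦ by simp }

theorem tailHeadEquiv_apply {n : ℕ} (x : Fin (n + 1) → ℝ) :
    tailHeadEquiv n x = (fun i ↦ x i.succ, x 0) := rfl

/-- `ℝ^{n+1} ≃ ℝⁿ × ℝ`, splitting off the last coordinate. -/
def initLastEquiv (n : ℕ) : (Fin (n + 1) → ℝ) ≃L[ℝ] (Fin n → ℝ) × ℝ :=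
  LinearEquiv.toContinuousLinearEquiv
    { toFun := fun x ↦ (fun i ↦ x i.castSucc, x (Fin.last n))
      invFun := fun p ↦ Fin.snoc (α := fun _ ↦ ℝ) p.1 p.2
      map_add' := fun _ _ ↦ rfl
      map_smul' := fun _ _ ↦ rfl
      left_inv := fun x ↦ Fin.snoc_init_self x
      right_inv := fun p ↦ by simp }

/-- `ℝⁿ × ℝⁿ ≃ ℝ^{2n}`, by concatenation. -/
def concatEquiv (n : ℕ) : ((Fin n → ℝ) × (Fin n → ℝ)) ≃L[ℝ] (Fin (2 * n) → ℝ) :=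
  LinearEquiv.toContinuousLinearEquiv
    { toFun := fun p k ↦ if h : k.val < n then p.1 ⟨k, h⟩ else p.2 ⟨k - n, by omega⟩
      invFun := fun y ↦ (fun i ↦ y ⟨i, by omega⟩, fun i ↦ y ⟨n + i, by omega⟩)
      map_add' := fun p q ↦ by
        ext k
        by_cases h : k.val < n <;> simp [h]
      map_smul' := fun c p ↦ by
        ext k
        by_cases h : k.val < n <;> simp [h]
      left_inv := fun p ↦ by simp
      right_inv := fun y ↦ by
        ext k
        by_cases h : k.val < n
        · simp [h]
        · simp [h, Nat.add_sub_cancel' (not_lt.1 h)] }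

theorem whitneyNF_eq_concatEquiv {n : ℕ} (hn : 0 < n) (x : Fin (n + 1) → ℝ) :
    whitneyNF n x = concatEquiv n ((initLastEquiv n x).1, fun i ↦
      if i = ⟨n - 1, by omega⟩ then (initLastEquiv n x).2 ^ 2
      else (initLastEquiv n x).2 * (initLastEquiv n x).1 i) := by
  ext k
  have hk := k.2
  change whitneyNF n x k = if h : k.val < n then x ⟨k, by omega⟩ else
    if (⟨k - n, by omega⟩ : Fin n) = ⟨n - 1, by omega⟩ then x (Fin.last n) ^ 2 else
      x (Fin.last n) * x ⟨k - n, by omega⟩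
  have hl : xhat' x n = x (Fin.last n) := by simp [xhat', Fin.last]
  unfold whitneyNF
  rw [hl]
  by_cases h1 : k.val < n
  · simp [h1, xhat', show k.val < n + 1 by omega]
  · by_cases h2 : k.val < 2 * n - 1
    · have h3 : ¬ (k.val - n = n - 1) := by omega
      simp [h1, h2, h3, xhat', show k.val - n < n + 1 by omega]
      exact mul_comm _ _
    · have h3 : k.val - n = n - 1 := by omega
      simp [h1, h2, h3]

theorem SmoothNear.isDiffeoGerm {k : ℕ} {σ : (Fin k → ℝ) → (Fin k → ℝ)} (hσ : SmoothNear σ 0)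
    (h0 : σ 0 = 0) (hi : Function.Injective (fderiv ℝ σ 0)) : IsDiffeoGerm σ :=
  ⟨h0, hσ.contDiffAt,
    (LinearEquiv.isUnit_det' (LinearEquiv.ofInjectiveEndo
      (fderiv ℝ σ 0).toLinearMap hi)).ne_zero⟩

theorem IsDiffeoGerm.bijective {k : ℕ} {σ : (Fin k → ℝ) → (Fin k → ℝ)} (h : IsDiffeoGerm σ) :
    Function.Bijective (fderiv ℝ σ 0) :=
  (LinearMap.equivOfDetNeZero (fderiv ℝ σ 0).toLinearMap h.2.2).bijective

section Frame

variable {n : ℕ} {g : ℝ → Fin (2 * n) → ℝ} {d : Fin n → ℝ → Fin (2 * n) → ℝ}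
  {a : Fin n → ℝ → ℝ}

theorem aEquiv_whitneyNF_of_ne_zero (hn : 0 < n)
    (hg : SmoothNear g 0) (hd : ∀ i, SmoothNear (d i) 0) (ha : ∀ i, SmoothNear (a i) 0)
    (hg0 : g 0 = 0) (hgd : ∀ᶠ t in 𝓝 0, deriv g t = ∑ i, a i t • d i t)
    (hli : LinearIndependent ℝ (Sum.elim (fun i ↦ d i 0) fun i ↦ deriv (d i) 0))
    (ha0 : (fun i ↦ a i 0) ≠ 0) :
    AEquiv (fun x ↦ planeFamily g d (tailHeadEquiv n x)) (whitneyNF n) := by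
  have : Nonempty (Fin n ⊕ Fin n) := ⟨.inl ⟨0, hn⟩⟩
  let b := basisOfLinearIndependentOfCardEqFinrank hli (by simp [two_mul])
  let L := (b.equivFun.trans
    (LinearEquiv.sumArrowLequivProdArrow (Fin n) (Fin n) ℝ ℝ)).toContinuousLinearEquiv
  have hb : ∀ j, b j = Sum.elim (fun i ↦ d i 0) (fun i ↦ deriv (d i) 0) j := fun j ↦ by simp [b]
  have hL : ∀ j, L (b j) = (fun i ↦ if j = .inl i then 1 else 0,
      fun i ↦ if j = .inr i then 1 else 0) := fun j ↦ by
    ext i <;> simp [L, Finsupp.single_apply]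
  obtain ⟨Φ, κ, hΦ, hκ, hΦ0, hκ0, hΦi, hκi, h⟩ := exists_planeFamily_normalForm
    (⟨n - 1, by omega⟩ : Fin n) L
    (fun i ↦ by
      have := hL (.inl i)
      rw [hb] at this
      refine this.trans ?_
      ext j <;> simp [Pi.single_apply, eq_comm])
    (fun i ↦ by
      have := hL (.inr i)
      rw [hb] at this
      refine this.trans ?_
      ext j <;> simp [Pi.single_apply, eq_comm]) hg hd ha hg0 hgd ha0
  let S := initLastEquiv n
  let T := tailHeadEquiv n
  let R := concatEquiv n
  have hS : SmoothNear (fun x ↦ κ (S x)) 0 :=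
    SmoothNear.comp (by rwa [map_zero]) S.contDiff.smoothNear
  have hSd : HasFDerivAt (fun x ↦ T.symm (κ (S x)))
      ((T.symm : (Fin n → ℝ) × ℝ →L[ℝ] _).comp ((fderiv ℝ κ 0).comp (S : _ →L[ℝ] _))) 0 := by
    refine T.symm.hasFDerivAt.comp 0 (HasFDerivAt.comp 0 ?_ S.hasFDerivAt)
    rw [map_zero]
    exact hκ.differentiableAt.hasFDerivAt
  have hRd : HasFDerivAt (fun y ↦ R (Φ y))
      ((R : (Fin n → ℝ) × (Fin n → ℝ) →L[ℝ] _).comp (fderiv ℝ Φ 0)) 0 :=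
    R.hasFDerivAt.comp 0 hΦ.differentiableAt.hasFDerivAt
  refine ⟨fun x ↦ T.symm (κ (S x)), fun y ↦ R (Φ y), SmoothNear.isDiffeoGerm
    (SmoothNear.comp (g := T.symm) T.symm.contDiff.smoothNear hS) ?_ ?_,
    SmoothNear.isDiffeoGerm (SmoothNear.comp (g := R) R.contDiff.smoothNear hΦ) ?_ ?_, ?_⟩
  · simp only [map_zero, hκ0]
  · rw [hSd.fderiv]
    exact T.symm.injective.comp (hκi.comp S.injective)
  · simp only [map_zero, hΦ0]
  · rw [hRd.fderiv]
    exact R.injective.comp hΦi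
  · have hSt : Tendsto S (𝓝 0) (𝓝 0) := Continuous.tendsto' S.continuous _ _ (map_zero S)
    filter_upwards [hSt.eventually h] with x hx
    rw [T.apply_symm_apply, hx, whitneyNF_eq_concatEquiv hn]

theorem ne_zero_of_aEquiv_whitneyNF (hn : 0 < n)
    (hg : SmoothNear g 0) (hd : ∀ i, SmoothNear (d i) 0) (ha : ∀ i, SmoothNear (a i) 0)
    (hg0 : g 0 = 0) (hgd : ∀ᶠ t in 𝓝 0, deriv g t = ∑ i, a i t • d i t)
    (hli : LinearIndependent ℝ fun i ↦ d i 0)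
    (h : AEquiv (fun x ↦ planeFamily g d (tailHeadEquiv n x)) (whitneyNF n)) :
    (fun i ↦ a i 0) ≠ 0 := by
  obtain ⟨φ, Φ, hφ, hΦ, h⟩ := h
  let T := tailHeadEquiv n
  let k : Fin (2 * n) := ⟨2 * n - 1, by omega⟩
  have hNF : ∀ x : Fin (n + 1) → ℝ, whitneyNF n x k = x (Fin.last n) ^ 2 := fun x ↦ by
    simp [whitneyNF, k, xhat', Fin.last, show ¬ (2 * n - 1 < n) by omega]
  have hNFw : ∀ s : ℝ, whitneyNF n (s • Pi.single (Fin.last n) 1) = s ^ 2 • Pi.single k 1 := by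
    intro s
    ext j
    by_cases hj : j = k
    · rw [hj, hNF]
      simp
    · have hj' : j.val ≠ 2 * n - 1 := fun h ↦ hj (Fin.ext h)
      have h1 : ∀ q < n, xhat' (s • Pi.single (Fin.last n) 1 : Fin (n + 1) → ℝ) q = 0 := by
        intro q hq
        simp [xhat', show q < n + 1 by omega, Fin.ext_iff, hq.ne]
      have hj2 := j.2
      unfold whitneyNF
      by_cases h2 : j.val < n
      · simp [h2, h1, hj]
      · simp [h2, show j.val < 2 * n - 1 by omega, h1 (j.val - n) (by omega), hj]
  have hκd : HasFDerivAt (fun x ↦ T (φ x))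
      ((T : _ →L[ℝ] (Fin n → ℝ) × ℝ).comp (fderiv ℝ φ 0)) 0 :=
    T.hasFDerivAt.comp 0 (hφ.2.1.differentiableAt (by simp)).hasFDerivAt
  have hline : ∀ v : Fin (n + 1) → ℝ, Tendsto (fun s : ℝ ↦ s • v) (𝓝 0) (𝓝 0) := fun v ↦
    Continuous.tendsto' (by fun_prop) _ _ (zero_smul ℝ v)
  have h2 : (2 : WithTop ℕ∞) ≤ ((⊤ : ℕ∞) : WithTop ℕ∞) :=
    (WithTop.coe_le_coe (b := (2 : ℕ∞))).2 le_top
  refine ne_zero_of_planeFamily_comp hg hd ha hg0 hgd hli (κ := fun x ↦ T (φ x)) (Φ := Φ)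
    (T.contDiff.contDiffAt.comp 0 (hφ.2.1.of_le h2)) (hΦ.2.1.of_le h2) ?_ ?_ hΦ.bijective.1
    (w := Pi.single (Fin.last n) 1) (η := ContinuousLinearMap.proj k) (e := Pi.single k 1)
    (by simp) (fun v ↦ ?_) ?_
  · simp only [hφ.1, map_zero]
  · rw [hκd.fderiv]
    exact T.surjective.comp hφ.bijective.2
  · have h1 : HasDerivAt (fun s : ℝ ↦ (s * v (Fin.last n)) ^ 2) 0 0 := by
      simpa using ((hasDerivAt_id (0 : ℝ)).mul_const (v (Fin.last n))).fun_pow 2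
    refine h1.congr_of_eventuallyEq ?_
    filter_upwards [(hline v).eventually h] with s hs
    simp only [T, hs, ContinuousLinearMap.proj_apply, hNF, Pi.smul_apply, smul_eq_mul]
  · filter_upwards [(hline _).eventually h] with s hs
    rw [← hNFw]
    exact hs

end Frame

theorem dp_eq_dotProduct {N : ℕ} (v w : Fin N → ℝ) : dp v w = v ⬝ᵥ w := rfl

theorem eq_sum_dp_smul {n : ℕ} {x : Fin (2 * n) → ℝ} {e e' : Fin n → Fin (2 * n) → ℝ}
    (hli : LinearIndependent ℝ (Sum.elim e e'))
    (he : ∀ i j, dp (e i) (e j) = if i = j then 1 else 0) (hee' : ∀ i j, dp (e i) (e' j) = 0)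
    (hx : ∀ i, dp x (e' i) = 0) : x = ∑ i, dp x (e i) • e i := by
  simp only [dp_eq_dotProduct] at *
  have hspan := hli.span_eq_top_of_card_eq_finrank' (by simp [two_mul])
  rw [← sub_eq_zero]
  refine dotProduct_eq_zero _ fun w ↦ ?_
  have hw : w ∈ Submodule.span ℝ (Set.range (Sum.elim e e')) := hspan ▸ Submodule.mem_top
  induction hw using Submodule.span_induction with
  | mem w hw =>
    obtain ⟨i | i, rfl⟩ := hw
    · simp [sub_dotProduct, sum_dotProduct, he]
    · simp [sub_dotProduct, sum_dotProduct, hee', hx]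
  | zero => simp
  | add y z _ _ hy hz => rw [dotProduct_add, hy, hz, add_zero]
  | smul c y _ hy => rw [dotProduct_smul, hy, smul_zero]

theorem SmoothNear.of_contDiffOn {E F : Type} [NormedAddCommGroup E] [NormedSpace ℝ E]
    [NormedAddCommGroup F] [NormedSpace ℝ F] {f : E → F} {s : Set E} {x : E} (hs : IsOpen s)
    (hf : ContDiffOn ℝ ∞ f s) (hx : x ∈ s) : SmoothNear f x := by
  filter_upwards [hs.mem_nhds hx] with y hy using hf.contDiffAt (hs.mem_nhds hy)

theorem SmoothNear.comp_const_add {F : Type} [NormedAddCommGroup F] [NormedSpace ℝ F] {f : ℝ → F}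
    {t : ℝ} (hf : SmoothNear f t) : SmoothNear (fun s ↦ f (t + s)) 0 :=
  SmoothNear.comp (g := f) (by rwa [add_zero]) (contDiff_const.add contDiff_id).smoothNear

theorem SmoothNear.dp {E : Type} [NormedAddCommGroup E] [NormedSpace ℝ E] {N : ℕ}
    {f h : E → Fin N → ℝ} {x : E} (hf : SmoothNear f x) (hh : SmoothNear h x) :
    SmoothNear (fun y ↦ dp (f y) (h y)) x :=
  .sum fun i ↦ (hf.apply i).mul (hh.apply i)

/-- If `γ` is a striction curve, then for each `t₀ ∈ J` the germ of
`F_{(γ,δ)}` at the singular point `(t₀,0,…,0)` (translated to a germ at `0`) is a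
`1`-Morin singularity — i.e. `A`-equivalent to
`(x_1,…,x_n, x_1x_{n+1},…,x_{n-1}x_{n+1}, x_{n+1}²)` — if and only if `γ'(t₀) ≠ 0`. -/
theorem stmt12 {n : ℕ} (hn : 0 < n) (J : Set ℝ) (hJ : IsOpen J)
    (γ : ℝ → (Fin (2 * n) → ℝ)) (δ : Fin n → ℝ → (Fin (2 * n) → ℝ))
    (hγ : ContDiffOn ℝ (⊤ : ℕ∞) γ J) (hδ : ∀ i, ContDiffOn ℝ (⊤ : ℕ∞) (δ i) J)
    (horth : ∀ t ∈ J, ∀ i j, dp (δ i t) (δ j t) = if i = j then 1 else 0)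
    (hperp : ∀ t ∈ J, ∀ i j, dp (δ i t) (deriv (δ j) t) = 0)
    (hlin : ∀ t ∈ J,
      LinearIndependent ℝ (Sum.elim (fun i => δ i t) (fun i => deriv (δ i) t)))
    (hstr : ∀ t ∈ J, ∀ i, dp (deriv γ t) (deriv (δ i) t) = 0) :
    ∀ t₀ ∈ J,
      (AEquiv (fun x => ruledF γ δ (bpt t₀ + x) - ruledF γ δ (bpt t₀)) (whitneyNF n) ↔
        deriv γ t₀ ≠ 0) := by
  intro t₀ ht₀
  let g : ℝ → Fin (2 * n) → ℝ := fun t ↦ γ (t₀ + t) - γ t₀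
  let d : Fin n → ℝ → Fin (2 * n) → ℝ := fun i t ↦ δ i (t₀ + t)
  let a : Fin n → ℝ → ℝ := fun i t ↦ dp (deriv γ (t₀ + t)) (δ i (t₀ + t))
  have hγ' : SmoothNear γ t₀ := .of_contDiffOn hJ hγ ht₀
  have hg : SmoothNear g 0 := hγ'.comp_const_add.sub contDiff_const.smoothNear
  have hd : ∀ i, SmoothNear (d i) 0 := fun i ↦
    (SmoothNear.of_contDiffOn hJ (hδ i) ht₀).comp_const_add
  have ha : ∀ i, SmoothNear (a i) 0 := fun i ↦ hγ'.deriv.comp_const_add.dp (hd i)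
  have hdd : ∀ i t, deriv (d i) t = deriv (δ i) (t₀ + t) := fun i t ↦ deriv_comp_const_add ..
  have hγd : ∀ t ∈ J, deriv γ t = ∑ i, dp (deriv γ t) (δ i t) • δ i t := fun t ht ↦
    eq_sum_dp_smul (hlin t ht) (horth t ht) (hperp t ht) (hstr t ht)
  have hgd : ∀ᶠ t in 𝓝 0, deriv g t = ∑ i, a i t • d i t := by
    have h1 : Tendsto (fun t ↦ t₀ + t) (𝓝 0) (𝓝 t₀) :=
      Continuous.tendsto' (by fun_prop) _ _ (add_zero t₀)
    filter_upwards [h1.eventually (hJ.mem_nhds ht₀)] with t ht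
    rw [← hγd _ ht, deriv_sub_const, deriv_comp_const_add]
  have hli : LinearIndependent ℝ (Sum.elim (fun i ↦ d i 0) fun i ↦ deriv (d i) 0) := by
    simpa only [hdd, d, add_zero] using hlin t₀ ht₀
  have hf : (fun x ↦ ruledF γ δ (bpt t₀ + x) - ruledF γ δ (bpt t₀)) =
      fun x ↦ planeFamily g d (tailHeadEquiv n x) := by
    ext1 x
    simp [ruledF, bpt, planeFamily, tailHeadEquiv_apply, g, d]
    abel
  have ha0 : (fun i ↦ a i 0) ≠ 0 ↔ deriv γ t₀ ≠ 0 := by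
    refine not_congr ⟨fun h ↦ ?_, fun h ↦ ?_⟩
    · rw [hγd t₀ ht₀]
      refine Finset.sum_eq_zero fun i _ ↦ ?_
      have := congrFun h i
      simp only [a, add_zero, Pi.zero_apply] at this
      rw [this, zero_smul]
    · ext i
      simp [a, h, dp]
  rw [hf, ← ha0]
  exact ⟨ne_zero_of_aEquiv_whitneyNF hn hg hd ha (sub_eq_zero.2 (by rw [add_zero])) hgd
      (hli.comp Sum.inl Sum.inl_injective),
    aEquiv_whitneyNF_of_ne_zero hn hg hd ha (sub_eq_zero.2 (by rw [add_zero])) hgd hli⟩
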